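/- arXiv:1804.02046 — 2 statements merged into one kernel-verified Lean document; each statement's English description precedes it below -/
import Mathlib

section
/- Let n ≥ 1 be an integer and i ∈ {1,2}. Define the rational functions f_n(x) = n μ (γ+n−1) A_{1,n}(x) / ((1−μ) B_{1,n}(x)) − n + 1 and h_n(x) = −( μ(γ+n−1) A_{1,n}(x)/(1−μ) − B_{1,n}(x) ). Then for every real x such that ⟨x−α⟩_i^{j+1} ≠ 0, B_{1,n}(x) ≠ 0, and f_n(x) − 1 + m ≠ 0 for all integers 0 ≤ m ≤ n−1, the Sobolev orthogonal polynomial has the hypergeometric representation Q_n^{(i)}(x) = (γ)_{n−1} (μ/(μ−1))^{n−1} · h_n(x) · ∑_{k=0}^{n} ((−n)_k (−x)_k (f_n(x))_k / ((γ)_k (f_n(x)−1)_k)) · (1 − μ^{−1})^k / k!. -/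
open Finset Filter Topology Polynomial

noncomputable section

/-- Pochhammer symbol `(a)_k = a(a+1)⋯(a+k−1)`. -/
def poch (a : ℝ) (k : ℕ) : ℝ := ∏ m ∈ Finset.range k, (a + m)

/-- Falling factorial `[x]_k = x(x−1)⋯(x−k+1)`. -/
def fall (x : ℝ) (k : ℕ) : ℝ := ∏ m ∈ Finset.range k, (x - m)

/-- `⟨x⟩_i^k`: falling factorial for `i = 1`, Pochhammer symbol for `i = 2`. -/
def br (i : ℕ) (x : ℝ) (k : ℕ) : ℝ := if i = 1 then fall x k else poch x k

/-- Forward (`i = 1`) resp. backward (`i = 2`) difference operator `𝒟_i`. -/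
def Dop (i : ℕ) (f : ℝ → ℝ) : ℝ → ℝ :=
  fun x => if i = 1 then f (x + 1) - f x else f x - f (x - 1)

/-- Iterated difference operator `𝒟_i^k`. -/
def Dk (i k : ℕ) (f : ℝ → ℝ) : ℝ → ℝ := (Dop i)^[k] f

/-- Kronecker delta `δ_{i,m}` (real valued). -/
def kdelta (i m : ℕ) : ℝ := if i = m then 1 else 0

/-- The shift `x ± 1`: `x + 1` for `i = 1`, `x - 1` for `i = 2`. -/
def sh (i : ℕ) (x : ℝ) : ℝ := if i = 1 then x + 1 else x - 1

/-- Monic Meixner polynomial `M_n(x)`. -/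
def MeixnerM (γ μ : ℝ) (n : ℕ) (x : ℝ) : ℝ :=
  poch γ n * (μ / (μ - 1)) ^ n *
    ∑ k ∈ Finset.range (n + 1),
      poch (-(n : ℝ)) k * poch (-x) k / poch γ k * (1 - μ⁻¹) ^ k / (Nat.factorial k : ℝ)

/-- Meixner inner product `⟨p,q⟩ = ∑_{x≥0} p(x)q(x) μ^x (γ)_x / x!`. -/
def mIP (γ μ : ℝ) (p q : ℝ → ℝ) : ℝ :=
  ∑' x : ℕ, p x * q x * μ ^ x * poch γ x / (Nat.factorial x : ℝ)

/-- Squared Meixner norm `‖M_n‖²`. -/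
def nrm2 (γ μ : ℝ) (n : ℕ) : ℝ := mIP γ μ (MeixnerM γ μ n) (MeixnerM γ μ n)

/-- Kernel `K_n^{(l,m)}(x,y)` for the operator `𝒟_i`. -/
def Klm (γ μ : ℝ) (i l m n : ℕ) (x y : ℝ) : ℝ :=
  ∑ k ∈ Finset.range (n + 1),
    Dk i l (MeixnerM γ μ k) x * Dk i m (MeixnerM γ μ k) y / nrm2 γ μ k

/-- Sobolev inner product `⟨p,q⟩_λ = ⟨p,q⟩ + λ 𝒟_i^j p(α) 𝒟_i^j q(α)`. -/
def sIP (γ μ lam α : ℝ) (i j : ℕ) (p q : ℝ → ℝ) : ℝ :=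
  mIP γ μ p q + lam * Dk i j p α * Dk i j q α

/-- `Q` is the monic Sobolev orthogonal polynomial of degree `n`. -/
def IsSobolevOP (γ μ lam α : ℝ) (i j n : ℕ) (Q : Polynomial ℝ) : Prop :=
  Q.Monic ∧ Q.natDegree = n ∧
    ∀ p : Polynomial ℝ, p.degree < (n : WithBot ℕ) →
      sIP γ μ lam α i j (fun x => Q.eval x) (fun x => p.eval x) = 0

/-- Coefficient `a_n^{(k)}`. -/
def acoef (γ μ lam α : ℝ) (i j n k : ℕ) : ℝ :=
  -(lam * (Nat.factorial j : ℝ) * Dk i j (MeixnerM γ μ n) α * Dk i k (MeixnerM γ μ (n - 1)) α) /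
    ((Nat.factorial k : ℝ) * nrm2 γ μ (n - 1) * (1 + lam * Klm γ μ i j j (n - 1) α α))

/-- Coefficient `b_n^{(k)}`. -/
def bcoef (γ μ lam α : ℝ) (i j n k : ℕ) : ℝ :=
  lam * (Nat.factorial j : ℝ) * Dk i j (MeixnerM γ μ n) α * Dk i k (MeixnerM γ μ n) α /
    ((Nat.factorial k : ℝ) * nrm2 γ μ (n - 1) * (1 + lam * Klm γ μ i j j (n - 1) α α))

/-- Rational function `A_{1,n}(x)`. -/
def A1 (γ μ lam α : ℝ) (i j n : ℕ) (x : ℝ) : ℝ :=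
  1 + (1 / br i (x - α) (j + 1)) *
    ∑ k ∈ Finset.range (j + 1), acoef γ μ lam α i j n k * br i (x - α) k

/-- Rational function `B_{1,n}(x)`. -/
def B1 (γ μ lam α : ℝ) (i j n : ℕ) (x : ℝ) : ℝ :=
  (1 / br i (x - α) (j + 1)) *
    ∑ k ∈ Finset.range (j + 1), bcoef γ μ lam α i j n k * br i (x - α) k

/-- Meixner recurrence coefficient `α_n`. -/
def alphaR (γ μ : ℝ) (n : ℕ) : ℝ := ((n : ℝ) * (1 + μ) + μ * γ) / (1 - μ)

/-- Meixner recurrence coefficient `β_n`. -/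
def betaR (γ μ : ℝ) (n : ℕ) : ℝ := (n : ℝ) * μ * ((n : ℝ) + γ - 1) / (1 - μ) ^ 2

/-- Rational function `A_{2,n}(x)`. -/
def A2 (γ μ lam α : ℝ) (i j n : ℕ) (x : ℝ) : ℝ :=
  -(B1 γ μ lam α i j (n - 1) x) / betaR γ μ (n - 1)

/-- Rational function `B_{2,n}(x)`. -/
def B2 (γ μ lam α : ℝ) (i j n : ℕ) (x : ℝ) : ℝ :=
  A1 γ μ lam α i j (n - 1) x + A2 γ μ lam α i j n x * (alphaR γ μ (n - 1) - x)

/-- Rational function `C_{1,n}(x)`. -/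
def C1 (γ μ lam α : ℝ) (i j n : ℕ) (x : ℝ) : ℝ :=
  (x + γ * kdelta i 1) * Dop i (A1 γ μ lam α i j n) x + (n : ℝ) * A1 γ μ lam α i j n (sh i x)
    - ((n : ℝ) - 1) * ((n : ℝ) + γ - 2) * μ ^ kdelta i 2 * B1 γ μ lam α i j n (sh i x) /
        (betaR γ μ (n - 1) * (1 - μ))

/-- Rational function `D_{1,n}(x)`. -/
def D1 (γ μ lam α : ℝ) (i j n : ℕ) (x : ℝ) : ℝ :=
  (x + γ * kdelta i 1) * Dop i (B1 γ μ lam α i j n) x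
    + ((n : ℝ) - 1) * B1 γ μ lam α i j n (sh i x)
    + ((n : ℝ) - 1) * ((n : ℝ) + γ - 2) * (x - alphaR γ μ (n - 1)) * μ ^ kdelta i 2 *
        B1 γ μ lam α i j n (sh i x) / (betaR γ μ (n - 1) * (1 - μ))
    + (n : ℝ) * ((n : ℝ) + γ - 1) * μ ^ kdelta i 2 * A1 γ μ lam α i j n (sh i x) / (1 - μ)

/-- Rational function `C_{2,n}(x)`. -/
def C2 (γ μ lam α : ℝ) (i j n : ℕ) (x : ℝ) : ℝ :=
  -(D1 γ μ lam α i j (n - 1) x) / betaR γ μ (n - 1)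

/-- Rational function `D_{2,n}(x)`. -/
def D2 (γ μ lam α : ℝ) (i j n : ℕ) (x : ℝ) : ℝ :=
  C1 γ μ lam α i j (n - 1) x + C2 γ μ lam α i j n x * (alphaR γ μ (n - 1) - x)

/-- `A_{m,n}(x)` for `m = 1, 2`. -/
def Aa (γ μ lam α : ℝ) (i j n m : ℕ) (x : ℝ) : ℝ :=
  if m = 1 then A1 γ μ lam α i j n x else A2 γ μ lam α i j n x

/-- `B_{m,n}(x)` for `m = 1, 2`. -/
def Bb (γ μ lam α : ℝ) (i j n m : ℕ) (x : ℝ) : ℝ :=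
  if m = 1 then B1 γ μ lam α i j n x else B2 γ μ lam α i j n x

/-- `C_{k,n}(x)` for `k = 1, 2`. -/
def Cc (γ μ lam α : ℝ) (i j n k : ℕ) (x : ℝ) : ℝ :=
  if k = 1 then C1 γ μ lam α i j n x else C2 γ μ lam α i j n x

/-- `D_{k,n}(x)` for `k = 1, 2`. -/
def Dd (γ μ lam α : ℝ) (i j n k : ℕ) (x : ℝ) : ℝ :=
  if k = 1 then D1 γ μ lam α i j n x else D2 γ μ lam α i j n x

/-- `Λ_{m,n}^{(k)}(x) = (−1)^k (C_{k,n}(x) B_{m,n}(x) − A_{m,n}(x) D_{k,n}(x))`. -/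
def Lam (γ μ lam α : ℝ) (i j n m k : ℕ) (x : ℝ) : ℝ :=
  (-1 : ℝ) ^ k * (Cc γ μ lam α i j n k x * Bb γ μ lam α i j n m x
    - Aa γ μ lam α i j n m x * Dd γ μ lam α i j n k x)

/-- `Θ_n(x) = A_{1,n}(x) B_{2,n}(x) − B_{1,n}(x) A_{2,n}(x)`. -/
def Theta (γ μ lam α : ℝ) (i j n : ℕ) (x : ℝ) : ℝ :=
  A1 γ μ lam α i j n x * B2 γ μ lam α i j n x - B1 γ μ lam α i j n x * A2 γ μ lam α i j n x

/-- `Θ̃_n(x) = (x + γ δ_{i,1}) Θ_n(x)`. -/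
def Thetatil (γ μ lam α : ℝ) (i j n : ℕ) (x : ℝ) : ℝ :=
  (x + γ * kdelta i 1) * Theta γ μ lam α i j n x

namespace MeixnerSobolev

lemma degree_sub_coeff_mul_lt {T q : ℝ[X]} {m : ℕ} (hT : T.Monic) (hm : T.natDegree = m)
    (hq : q.degree < ((m + 1 : ℕ) : WithBot ℕ)) :
    (q - C (q.coeff m) * T).degree < (m : WithBot ℕ) := by
  rw [degree_lt_iff_coeff_zero] at hq ⊢
  intro k hk
  rcases hk.eq_or_lt with rfl | hk
  · have : T.coeff m = 1 := hm ▸ hT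
    simp [this]
  · simp [hq k hk, coeff_eq_zero_of_natDegree_lt (hm ▸ hk : T.natDegree < k)]

/-- Induction along a sequence of monic polynomials, one in each degree. -/
lemma degree_lt_induction {T : ℕ → ℝ[X]} (hT : ∀ n, (T n).Monic) (hd : ∀ n, (T n).natDegree = n)
    {p : ℝ[X] → Prop} (n : ℕ) (h0 : p 0)
    (hstep : ∀ m < n, ∀ (c : ℝ) (s : ℝ[X]), s.degree < (m : WithBot ℕ) → p s → p (C c * T m + s))
    (q : ℝ[X]) (hq : q.degree < (n : WithBot ℕ)) : p q := by
  induction n generalizing q with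
  | zero =>
    rw [degree_lt_iff_coeff_zero] at hq
    rwa [show q = 0 from Polynomial.ext fun k => by simpa using hq k (Nat.zero_le k)]
  | succ n ih =>
    have hs := degree_sub_coeff_mul_lt (hT n) (hd n) hq
    have := hstep n n.lt_succ_self (q.coeff n) _ hs
      (ih (fun m hm => hstep m (hm.trans n.lt_succ_self)) _ hs)
    rwa [add_sub_cancel] at this

section Orthogonal

variable {ℓ : ℝ[X] →ₗ[ℝ] ℝ} {P : ℕ → ℝ[X]}

lemma apply_C_mul (φ : ℝ[X] →ₗ[ℝ] ℝ) (c : ℝ) (p : ℝ[X]) : φ (C c * p) = c * φ p := by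
  rw [← smul_eq_C_mul, map_smul, smul_eq_mul]

lemma eq_zero_of_orthogonal (hpos : ∀ p : ℝ[X], p ≠ 0 → 0 < ℓ (p * p)) {n : ℕ} {r : ℝ[X]}
    (hr : r.degree < (n : WithBot ℕ))
    (h : ∀ q : ℝ[X], q.degree < (n : WithBot ℕ) → ℓ (r * q) = 0) : r = 0 := by
  by_contra hne
  exact (hpos r hne).ne' (h r hr)

/-- The orthogonal expansion of a polynomial, read through a linear functional. -/
lemma sum_apply_mul_eq (hpos : ∀ p : ℝ[X], p ≠ 0 → 0 < ℓ (p * p)) (hP : ∀ n, (P n).Monic)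
    (hd : ∀ n, (P n).natDegree = n)
    (hort : ∀ (n : ℕ) (q : ℝ[X]), q.degree < (n : WithBot ℕ) → ℓ (P n * q) = 0)
    (φ : ℝ[X] →ₗ[ℝ] ℝ) (n : ℕ) (q : ℝ[X]) (hq : q.degree < (n : WithBot ℕ)) :
    ∑ k ∈ range n, φ (P k) * ℓ (P k * q) / ℓ (P k * P k) = φ q := by
  refine degree_lt_induction hP hd n (p := fun q =>
    ∑ k ∈ range n, φ (P k) * ℓ (P k * q) / ℓ (P k * P k) = φ q) (by simp) ?_ q hq
  intro m hm c s _ ih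
  have hz : ∀ k, k ≠ m → ℓ (P k * P m) = 0 := by
    intro k hk
    rcases lt_or_gt_of_ne hk with h | h
    · rw [mul_comm]
      exact hort _ _ (by rw [degree_eq_natDegree (hP k).ne_zero, hd]; exact_mod_cast h)
    · exact hort _ _ (by rw [degree_eq_natDegree (hP m).ne_zero, hd]; exact_mod_cast h)
  have key : ∑ k ∈ range n, φ (P k) * ℓ (P k * (C c * P m)) / ℓ (P k * P k) = c * φ (P m) := by
    rw [Finset.sum_eq_single m]
    · rw [mul_left_comm, apply_C_mul]
      have := (hpos (P m) (hP m).ne_zero).ne'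
      field_simp
    · intro k _ hk
      rw [mul_left_comm, apply_C_mul, hz k hk]
      simp
    · intro h
      exact absurd (mem_range.2 hm) h
  simp only [mul_add, map_add, add_div, Finset.sum_add_distrib, key, ih, apply_C_mul]

lemma apply_mul_top (hP : ∀ n, (P n).Monic) (hd : ∀ n, (P n).natDegree = n)
    (hort : ∀ (n : ℕ) (q : ℝ[X]), q.degree < (n : WithBot ℕ) → ℓ (P n * q) = 0)
    (n : ℕ) (q : ℝ[X]) (hq : q.degree < ((n + 1 : ℕ) : WithBot ℕ)) :
    ℓ (P n * q) = q.coeff n * ℓ (P n * P n) := by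
  have h := hort n _ (degree_sub_coeff_mul_lt (hP n) (hd n) hq)
  rw [mul_sub, map_sub, mul_left_comm, apply_C_mul] at h
  linarith

/-- The Christoffel–Darboux kernel `∑_{k<n} P_k(x) P_k / ℓ(P_k²)` as a polynomial. -/
def kernelPoly (ℓ : ℝ[X] →ₗ[ℝ] ℝ) (P : ℕ → ℝ[X]) (n : ℕ) (x : ℝ) : ℝ[X] :=
  ∑ k ∈ range n, C ((P k).eval x / ℓ (P k * P k)) * P k

lemma kernelPoly_reproducing (hpos : ∀ p : ℝ[X], p ≠ 0 → 0 < ℓ (p * p)) (hP : ∀ n, (P n).Monic)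
    (hd : ∀ n, (P n).natDegree = n)
    (hort : ∀ (n : ℕ) (q : ℝ[X]), q.degree < (n : WithBot ℕ) → ℓ (P n * q) = 0)
    (n : ℕ) (x : ℝ) (q : ℝ[X]) (hq : q.degree < (n : WithBot ℕ)) :
    ℓ (kernelPoly ℓ P n x * q) = q.eval x := by
  have h := sum_apply_mul_eq hpos hP hd hort (Polynomial.leval x) n q hq
  simp only [leval_apply] at h
  rw [← h, kernelPoly, Finset.sum_mul, map_sum]
  refine Finset.sum_congr rfl fun k _ => ?_
  rw [mul_assoc, apply_C_mul]
  ring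

lemma degree_kernelPoly_lt (hd : ∀ n, (P n).natDegree = n) (n : ℕ) (x : ℝ) :
    (kernelPoly ℓ P n x).degree < (n : WithBot ℕ) := by
  rw [degree_lt_iff_coeff_zero]
  intro m hm
  rw [kernelPoly, finsetSum_coeff]
  refine Finset.sum_eq_zero fun k hk => ?_
  rw [coeff_C_mul, coeff_eq_zero_of_natDegree_lt, mul_zero]
  rw [hd]
  exact (mem_range.1 hk).trans_le hm

/-- The Christoffel–Darboux formula. -/
lemma christoffel_darboux (hpos : ∀ p : ℝ[X], p ≠ 0 → 0 < ℓ (p * p)) (hP : ∀ n, (P n).Monic)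
    (hd : ∀ n, (P n).natDegree = n)
    (hort : ∀ (n : ℕ) (q : ℝ[X]), q.degree < (n : WithBot ℕ) → ℓ (P n * q) = 0) (n : ℕ) (x : ℝ) :
    (C x - X) * kernelPoly ℓ P (n + 1) x =
      C ((ℓ (P n * P n))⁻¹) * (C ((P (n + 1)).eval x) * P n - C ((P n).eval x) * P (n + 1)) := by
  have hN := (hpos (P n) (hP n).ne_zero).ne'
  have hdeg : ∀ k, (P k).degree < ((k + 1 : ℕ) : WithBot ℕ) := fun k => by
    rw [degree_eq_natDegree (hP k).ne_zero, hd]; exact_mod_cast k.lt_succ_self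
  have hlin : ∀ (m : ℕ) (q : ℝ[X]), q.degree < (m : WithBot ℕ) →
      ((C x - X) * q).degree < ((m + 1 : ℕ) : WithBot ℕ) ∧
        ((C x - X) * q).coeff m = -(if m = 0 then 0 else q.coeff (m - 1)) := by
    intro m q hq
    rw [degree_lt_iff_coeff_zero] at hq
    refine ⟨?_, ?_⟩
    · rw [degree_lt_iff_coeff_zero]
      rintro (_ | k) hk
      · omega
      · rw [sub_mul, coeff_sub, coeff_C_mul, coeff_X_mul, hq _ (by omega), hq _ (by omega)]
        simp
    · rcases m with _ | m
      · simp [hq 0 le_rfl]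
      · simp [sub_mul, coeff_X_mul, hq (m + 1) le_rfl]
  rw [← sub_eq_zero]
  refine eq_zero_of_orthogonal hpos (n := n + 1) ?_ ?_
  · have h1 := hlin (n + 1) _ (degree_kernelPoly_lt (ℓ := ℓ) hd (n + 1) x)
    have hc : (P (n + 1)).coeff (n + 1) = 1 := by simpa [Monic, leadingCoeff, hd] using hP (n + 1)
    have hc' : (P n).coeff n = 1 := by simpa [Monic, leadingCoeff, hd] using hP n
    have hk : (kernelPoly ℓ P (n + 1) x).coeff n = (P n).eval x / ℓ (P n * P n) := by
      rw [kernelPoly, Finset.sum_range_succ, ← kernelPoly, coeff_add,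
        (degree_lt_iff_coeff_zero _ _).1 (degree_kernelPoly_lt (ℓ := ℓ) hd n x) n le_rfl]
      simp [hc']
    rw [degree_lt_iff_coeff_zero]
    intro m hm
    rcases hm.eq_or_lt with rfl | hm
    · rw [coeff_sub, h1.2]
      have hz : (P n).coeff (n + 1) = 0 := (degree_lt_iff_coeff_zero _ _).1 (hdeg n) _ le_rfl
      simp [hk, hz, hc]
      ring
    · have h2 := (degree_lt_iff_coeff_zero _ _).1 h1.1 m hm
      have h3 := (degree_lt_iff_coeff_zero _ _).1 (hdeg n) m (by omega)
      have h4 := (degree_lt_iff_coeff_zero _ _).1 (hdeg (n + 1)) m hm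
      simp [coeff_sub, coeff_C_mul, h2, h3, h4]
  · intro q hq
    obtain ⟨hq1, hq2⟩ := hlin (n + 1) q hq
    have hs := degree_sub_coeff_mul_lt (hP (n + 1)) (hd (n + 1)) hq1
    have hr := kernelPoly_reproducing hpos hP hd hort (n + 1) x _ hs
    have hK := hort (n + 1) _ (degree_kernelPoly_lt (ℓ := ℓ) hd (n + 1) x)
    rw [mul_sub, map_sub, mul_left_comm _ (C _), apply_C_mul, mul_comm _ (P (n + 1)), hK,
      hq2] at hr
    have h1 := apply_mul_top hP hd hort n q hq
    have h2 := hort (n + 1) q hq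
    rw [sub_mul, map_sub, mul_assoc, mul_left_comm (C x - X), mul_assoc, apply_C_mul,
      sub_mul (C _ * P n), map_sub, mul_assoc, mul_assoc, apply_C_mul, apply_C_mul, h1, h2]
    simp at hr
    rw [hr]
    field_simp
    ring

end Orthogonal

section Difference

variable {i : ℕ}

lemma Dk_succ (k : ℕ) (f : ℝ → ℝ) : Dk i (k + 1) f = Dop i (Dk i k f) :=
  Function.iterate_succ_apply' _ _ _

lemma Dk_add (k : ℕ) (f g : ℝ → ℝ) : Dk i k (f + g) = Dk i k f + Dk i k g := by
  induction k with
  | zero => rfl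
  | succ k ih =>
    rw [Dk_succ, Dk_succ, Dk_succ, ih]
    funext x
    simp only [Dop, Pi.add_apply]
    split_ifs <;> ring

lemma Dk_smul (k : ℕ) (c : ℝ) (f : ℝ → ℝ) : Dk i k (c • f) = c • Dk i k f := by
  induction k with
  | zero => rfl
  | succ k ih =>
    rw [Dk_succ, Dk_succ, ih]
    funext x
    simp only [Dop, Pi.smul_apply, smul_eq_mul]
    split_ifs <;> ring

/-- The functional `p ↦ 𝒟_i^k p(α)` on polynomials. -/
def diffFunctional (i k : ℕ) (α : ℝ) : ℝ[X] →ₗ[ℝ] ℝ where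
  toFun p := Dk i k (fun x => p.eval x) α
  map_add' p q := by
    have : (fun x => (p + q).eval x) = (fun x => p.eval x) + fun x => q.eval x := by
      funext x; simp
    rw [this, Dk_add, Pi.add_apply]
  map_smul' c p := by
    have : (fun x => (c • p).eval x) = c • fun x => p.eval x := by
      funext x; simp
    rw [this, Dk_smul]
    rfl

/-- The step of `⟨x⟩_i^k`: `-1` for falling factorials, `1` for Pochhammer symbols. -/
def brStep (i : ℕ) : ℝ := if i = 1 then -1 else 1

lemma br_succ (z : ℝ) (k : ℕ) : br i z (k + 1) = br i z k * (z + brStep i * k) := by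
  unfold br brStep fall poch
  split_ifs <;> rw [Finset.prod_range_succ] <;> ring

lemma Dk_succ_sub_mul (x : ℝ) (G : ℝ → ℝ) (k : ℕ) (y : ℝ) :
    Dk i (k + 1) (fun y => (x - y) * G y) y =
      (x - y + brStep i * (k + 1)) * Dk i (k + 1) G y - (k + 1) * Dk i k G y := by
  induction k generalizing y with
  | zero =>
    simp only [Dk, Function.iterate_succ, Function.iterate_zero, Function.comp, id, Dop, brStep]
    push_cast
    split_ifs <;> ring
  | succ k ih =>
    rw [Dk_succ (k + 1), Dk_succ (k + 1) G]
    have h := Dk_succ (i := i) k G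
    simp only [Dop, ih]
    simp only [h, Dop, brStep]
    push_cast
    split_ifs <;> ring

lemma br_mul_Dk (x α : ℝ) (G : ℝ → ℝ) (j : ℕ) :
    br i (x - α) (j + 1) * Dk i j G α =
      (j.factorial : ℝ) * ∑ k ∈ range (j + 1),
        br i (x - α) k / (k.factorial : ℝ) * Dk i k (fun y => (x - y) * G y) α := by
  induction j with
  | zero => simp [br, fall, poch, Dk]
  | succ j ih =>
    have hj : (j.factorial : ℝ) ≠ 0 := by exact_mod_cast j.factorial_ne_zero
    rw [Finset.sum_range_succ, mul_add, Nat.factorial_succ, Nat.cast_mul, mul_assoc, ← ih,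
      br_succ _ (j + 1), Dk_succ_sub_mul]
    push_cast
    field_simp
    ring

end Difference

section Meixner

lemma poch_succ (a : ℝ) (k : ℕ) : poch a (k + 1) = poch a k * (a + k) := by
  rw [poch, Finset.prod_range_succ, ← poch]

lemma poch_succ' (a : ℝ) (k : ℕ) : poch a (k + 1) = a * poch (a + 1) k := by
  rw [poch, Finset.prod_range_succ', mul_comm, Nat.cast_zero, add_zero, poch]
  congr 1
  exact Finset.prod_congr rfl fun m _ => by push_cast; ring

lemma poch_add (a : ℝ) (m k : ℕ) : poch a (m + k) = poch a m * poch (a + m) k := by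
  rw [poch, Finset.prod_range_add, poch, poch]
  simp [add_assoc]

lemma poch_pos {a : ℝ} (ha : 0 < a) (k : ℕ) : 0 < poch a k :=
  Finset.prod_pos fun _ _ => by positivity

lemma poch_neg_natCast (n k : ℕ) (hk : k ≤ n) :
    poch (-(n : ℝ)) k = (-1) ^ k * (n.choose k * k.factorial) := by
  induction k with
  | zero => simp [poch]
  | succ k ih =>
    have h : (n.choose (k + 1) : ℝ) * (k + 1) = n.choose k * (n - k) := by
      have := Nat.choose_succ_right_eq n k
      rw [← Nat.cast_sub (by omega : k ≤ n)]
      exact_mod_cast this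
    rw [poch_succ, ih (by omega), Nat.factorial_succ]
    push_cast
    rw [pow_succ]
    linear_combination (-1 : ℝ) ^ k * k.factorial * h

/-- The Meixner weight `μ^x (γ)_x / x!`. -/
def weight (γ μ : ℝ) (x : ℕ) : ℝ := μ ^ x * poch γ x / x.factorial

variable {γ μ : ℝ}

lemma weight_pos (hγ : 0 < γ) (hμ0 : 0 < μ) (x : ℕ) : 0 < weight γ μ x := by
  have := poch_pos hγ x
  unfold weight
  positivity

lemma weight_succ (x : ℕ) : weight γ μ (x + 1) = μ * (γ + x) / (x + 1) * weight γ μ x := by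
  have : (x.factorial : ℝ) ≠ 0 := by exact_mod_cast x.factorial_ne_zero
  have : (x : ℝ) + 1 ≠ 0 := by positivity
  rw [weight, weight, poch_succ, Nat.factorial_succ, pow_succ]
  push_cast
  field_simp

lemma summable_weight (hγ : 0 < γ) (hμ0 : 0 < μ) (hμ1 : μ < 1) : Summable (weight γ μ) := by
  refine summable_of_ratio_test_tendsto_lt_one hμ1
    (Eventually.of_forall fun x => (weight_pos hγ hμ0 x).ne') ?_
  have h : Tendsto (fun x : ℕ => μ + μ * (γ - 1) * (1 / ((x : ℝ) + 1))) atTop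
      (𝓝 (μ + μ * (γ - 1) * 0)) :=
    tendsto_const_nhds.add (tendsto_one_div_add_atTop_nhds_zero_nat.const_mul _)
  rw [mul_zero, add_zero] at h
  refine h.congr fun x => ?_
  have hw := weight_pos hγ hμ0 x
  rw [Real.norm_of_nonneg (weight_pos hγ hμ0 _).le, Real.norm_of_nonneg hw.le, weight_succ]
  have : (x : ℝ) + 1 ≠ 0 := by positivity
  field_simp
  ring

lemma tsum_weight_succ (hγ : 0 < γ) (hμ0 : 0 < μ) (hμ1 : μ < 1) :
    ∑' x, weight γ μ x = (1 - μ) * ∑' x, weight (γ + 1) μ x := by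
  have h1 := summable_weight (by linarith : 0 < γ + 1) hμ0 hμ1
  have h0 := summable_weight hγ hμ0 hμ1
  have hz : ∀ a : ℝ, weight a μ 0 = 1 := fun a => by simp [weight, poch]
  have hrec : ∀ x, weight γ μ (x + 1) = weight (γ + 1) μ (x + 1) - μ * weight (γ + 1) μ x := by
    intro x
    have : (x.factorial : ℝ) ≠ 0 := by exact_mod_cast x.factorial_ne_zero
    have : (x : ℝ) + 1 ≠ 0 := by positivity
    rw [weight_succ (γ := γ + 1), weight, weight, poch_succ', Nat.factorial_succ, pow_succ]
    push_cast
    field_simp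
    ring
  have e0 := h0.tsum_eq_zero_add
  have e1 := h1.tsum_eq_zero_add
  simp only [hrec] at e0
  rw [((summable_nat_add_iff 1).2 h1).tsum_sub (h1.mul_left μ), tsum_mul_left, hz] at e0
  rw [hz] at e1
  linarith

lemma tsum_weight_add (hγ : 0 < γ) (hμ0 : 0 < μ) (hμ1 : μ < 1) (k : ℕ) :
    ∑' x, weight (γ + k) μ x = (∑' x, weight γ μ x) / (1 - μ) ^ k := by
  have : 1 - μ ≠ 0 := by linarith
  induction k with
  | zero => simp
  | succ k ih =>
    rw [tsum_weight_succ (by positivity : 0 < γ + k) hμ0 hμ1] at ih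
    push_cast
    rw [← add_assoc, pow_succ, div_mul_eq_div_div, ← ih]
    field_simp

lemma hasSum_poch_neg_mul_weight (hμ0 : 0 < μ) (hμ1 : μ < 1) (k : ℕ) :
    ∀ {a : ℝ}, 0 < a → HasSum (fun x : ℕ => poch (-(x : ℝ)) k * weight a μ x)
      ((-μ) ^ k * poch a k * ∑' x, weight (a + k) μ x) := by
  induction k with
  | zero =>
    intro a ha
    simpa [poch] using (summable_weight ha hμ0 hμ1).hasSum
  | succ k ih =>
    intro a ha
    have h := (ih (by linarith : 0 < a + 1)).mul_left (-(μ * a))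
    rw [← hasSum_nat_add_iff' 1]
    simp only [Finset.sum_range_one, Nat.cast_zero, neg_zero, poch_succ' 0, zero_mul, sub_zero]
    have e1 : (fun x : ℕ => poch (-((x + 1 : ℕ) : ℝ)) (k + 1) * weight a μ (x + 1)) =
        fun x : ℕ => -(μ * a) * (poch (-(x : ℝ)) k * weight (a + 1) μ x) := by
      funext x
      have : (x.factorial : ℝ) ≠ 0 := by exact_mod_cast x.factorial_ne_zero
      have : (x : ℝ) + 1 ≠ 0 := by positivity
      rw [poch_succ', weight, weight, poch_succ', Nat.factorial_succ, pow_succ]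
      push_cast
      rw [show -((x : ℝ) + 1) + 1 = -x by ring]
      field_simp
    have e2 : (-μ) ^ (k + 1) * poch a (k + 1) * ∑' x, weight (a + (k + 1 : ℕ)) μ x =
        -(μ * a) * ((-μ) ^ k * poch (a + 1) k * ∑' x, weight (a + 1 + k) μ x) := by
      rw [poch_succ', pow_succ]
      push_cast
      rw [show a + ((k : ℝ) + 1) = a + 1 + k by ring]
      ring
    rw [e1, e2]
    exact h

/-- `(x + a)_m` as a polynomial in `x`. -/
def pochPoly (a : ℝ) (m : ℕ) : ℝ[X] := ∏ k ∈ range m, (X + C (a + k))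

lemma eval_pochPoly (a : ℝ) (m : ℕ) (x : ℝ) : (pochPoly a m).eval x = poch (a + x) m := by
  rw [pochPoly, eval_prod, poch]
  exact Finset.prod_congr rfl fun k _ => by simp; ring

lemma pochPoly_monic (a : ℝ) (m : ℕ) : (pochPoly a m).Monic :=
  monic_prod_of_monic _ _ fun _ _ => monic_X_add_C _

lemma natDegree_pochPoly (a : ℝ) (m : ℕ) : (pochPoly a m).natDegree = m := by
  rw [pochPoly, natDegree_prod_of_monic _ _ fun _ _ => monic_X_add_C _]
  simp only [natDegree_X_add_C, Finset.sum_const, Finset.card_range, smul_eq_mul, mul_one]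

/-- `(-x)_k` as a polynomial in `x`. -/
def fallPoly (k : ℕ) : ℝ[X] := C ((-1) ^ k) * ∏ m ∈ range k, (X - C (m : ℝ))

lemma eval_fallPoly (k : ℕ) (x : ℝ) : (fallPoly k).eval x = poch (-x) k := by
  rw [fallPoly, eval_mul, eval_prod, eval_C, poch]
  have h := Finset.prod_const (s := range k) (-1 : ℝ)
  rw [Finset.card_range] at h
  rw [← h, ← Finset.prod_mul_distrib]
  exact Finset.prod_congr rfl fun k _ => by simp; ring

lemma natDegree_prod_X_sub (k : ℕ) : (∏ m ∈ range k, (X - C (m : ℝ))).natDegree = k := by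
  rw [natDegree_prod_of_monic _ _ fun _ _ => monic_X_sub_C _]
  simp only [natDegree_X_sub_C, Finset.sum_const, Finset.card_range, smul_eq_mul, mul_one]

lemma natDegree_fallPoly_le (k : ℕ) : (fallPoly k).natDegree ≤ k :=
  (natDegree_C_mul_le _ _).trans (natDegree_prod_X_sub k).le

lemma coeff_fallPoly (k : ℕ) : (fallPoly k).coeff k = (-1) ^ k := by
  have h : (∏ m ∈ range k, (X - C (m : ℝ))).Monic :=
    monic_prod_of_monic _ _ fun _ _ => monic_X_sub_C _
  rw [Monic, leadingCoeff, natDegree_prod_X_sub] at h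
  rw [fallPoly, coeff_C_mul, h, mul_one]

/-- The Meixner polynomial as an element of `ℝ[X]`. -/
def meixnerPoly (γ μ : ℝ) (n : ℕ) : ℝ[X] :=
  C (poch γ n * (μ / (μ - 1)) ^ n) * ∑ k ∈ range (n + 1),
    C (poch (-(n : ℝ)) k / poch γ k * (1 - μ⁻¹) ^ k / (k.factorial : ℝ)) * fallPoly k

lemma eval_meixnerPoly (n : ℕ) (x : ℝ) : (meixnerPoly γ μ n).eval x = MeixnerM γ μ n x := by
  simp only [meixnerPoly, MeixnerM, eval_mul, eval_C, eval_finsetSum, eval_fallPoly]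
  congr 1
  exact Finset.sum_congr rfl fun k _ => by ring

lemma natDegree_meixnerPoly_le (n : ℕ) : (meixnerPoly γ μ n).natDegree ≤ n := by
  refine (natDegree_C_mul_le _ _).trans (natDegree_sum_le_of_forall_le _ _ fun k hk => ?_)
  exact (natDegree_C_mul_le _ _).trans
    ((natDegree_fallPoly_le k).trans (Nat.lt_succ_iff.1 (mem_range.1 hk)))

lemma coeff_meixnerPoly (hγ : 0 < γ) (hμ0 : 0 < μ) (hμ1 : μ < 1) (n : ℕ) :
    (meixnerPoly γ μ n).coeff n = 1 := by
  have hn : (n.factorial : ℝ) ≠ 0 := by exact_mod_cast n.factorial_ne_zero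
  have hp := (poch_pos hγ n).ne'
  have h1 : μ - 1 ≠ 0 := by linarith
  rw [meixnerPoly, coeff_C_mul, Finset.sum_range_succ, coeff_add, finsetSum_coeff,
    Finset.sum_eq_zero, zero_add, coeff_C_mul, coeff_fallPoly, poch_neg_natCast n n le_rfl]
  · have hz : (μ / (μ - 1)) ^ n * (1 - μ⁻¹) ^ n = 1 := by
      rw [← mul_pow, show μ / (μ - 1) * (1 - μ⁻¹) = 1 by field_simp, one_pow]
    have hs : (-1 : ℝ) ^ n * (-1) ^ n = 1 := by rw [← mul_pow]; simp
    rw [Nat.choose_self, Nat.cast_one, one_mul]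
    generalize (μ / (μ - 1)) ^ n = u at *
    generalize (1 - μ⁻¹) ^ n = v at *
    generalize (-1 : ℝ) ^ n = s at *
    field_simp
    linear_combination hz + u * v * hs
  · intro k hk
    rw [coeff_C_mul, coeff_eq_zero_of_natDegree_lt, mul_zero]
    exact (natDegree_fallPoly_le k).trans_lt (mem_range.1 hk)

lemma meixnerPoly_monic (hγ : 0 < γ) (hμ0 : 0 < μ) (hμ1 : μ < 1) (n : ℕ) :
    (meixnerPoly γ μ n).Monic :=
  monic_of_natDegree_le_of_coeff_eq_one n (natDegree_meixnerPoly_le n)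
    (coeff_meixnerPoly hγ hμ0 hμ1 n)

lemma natDegree_meixnerPoly (hγ : 0 < γ) (hμ0 : 0 < μ) (hμ1 : μ < 1) (n : ℕ) :
    (meixnerPoly γ μ n).natDegree = n :=
  natDegree_eq_of_le_of_coeff_ne_zero (natDegree_meixnerPoly_le n)
    (by rw [coeff_meixnerPoly hγ hμ0 hμ1]; exact one_ne_zero)

lemma pochPoly_mul_weight (m x : ℕ) :
    (pochPoly γ m).eval (x : ℝ) * weight γ μ x = poch γ m * weight (γ + m) μ x := by
  have h : poch γ x * poch (γ + x) m = poch γ m * poch (γ + m) x := by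
    rw [← poch_add, ← poch_add, add_comm]
  rw [eval_pochPoly, weight, weight]
  linear_combination μ ^ x / x.factorial * h

lemma summable_eval_mul_weight (hγ : 0 < γ) (hμ0 : 0 < μ) (hμ1 : μ < 1) (p : ℝ[X]) :
    Summable fun x : ℕ => p.eval (x : ℝ) * weight γ μ x := by
  refine degree_lt_induction (pochPoly_monic γ) (natDegree_pochPoly γ) (p.natDegree + 1)
    (p := fun p => Summable fun x : ℕ => p.eval (x : ℝ) * weight γ μ x) (by simp) ?_ p
    (degree_le_natDegree.trans_lt (by exact_mod_cast p.natDegree.lt_succ_self))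
  intro m _ c s _ hs
  have h := (summable_weight (by positivity : 0 < γ + m) hμ0 hμ1).mul_left (c * poch γ m)
  refine (h.add hs).congr fun x => ?_
  rw [eval_add, eval_mul, eval_C, add_mul, mul_assoc c (eval _ _), pochPoly_mul_weight, mul_assoc]

/-- The Meixner moment functional. -/
def moment (γ μ : ℝ) (hγ : 0 < γ) (hμ0 : 0 < μ) (hμ1 : μ < 1) : ℝ[X] →ₗ[ℝ] ℝ where
  toFun p := ∑' x : ℕ, p.eval (x : ℝ) * weight γ μ x
  map_add' p q := by
    simp only [eval_add, add_mul]
    exact (summable_eval_mul_weight hγ hμ0 hμ1 p).tsum_add (summable_eval_mul_weight hγ hμ0 hμ1 q)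
  map_smul' c p := by
    simp only [eval_smul, smul_eq_mul, mul_assoc, tsum_mul_left, RingHom.id_apply]

variable (hγ : 0 < γ) (hμ0 : 0 < μ) (hμ1 : μ < 1)

lemma moment_mul (p q : ℝ[X]) :
    moment γ μ hγ hμ0 hμ1 (p * q) = mIP γ μ (fun x => p.eval x) fun x => q.eval x := by
  refine tsum_congr fun x => ?_
  rw [eval_mul, weight]
  ring

lemma moment_pos (p : ℝ[X]) (hp : p ≠ 0) : 0 < moment γ μ hγ hμ0 hμ1 (p * p) := by
  obtain ⟨x, hx⟩ : ∃ x : ℕ, p.eval (x : ℝ) ≠ 0 := by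
    by_contra! h
    exact hp (eq_zero_of_infinite_isRoot p
      ((Set.infinite_range_of_injective Nat.cast_injective).mono
        (by rintro _ ⟨x, rfl⟩; exact h x)))
  refine (summable_eval_mul_weight hγ hμ0 hμ1 (p * p)).tsum_pos (fun y => ?_) x ?_
  · rw [eval_mul]
    exact mul_nonneg (mul_self_nonneg _) (weight_pos hγ hμ0 y).le
  · rw [eval_mul]
    exact mul_pos (mul_self_pos.2 hx) (weight_pos hγ hμ0 x)

lemma moment_pochPoly_mul_fallPoly (m k : ℕ) :
    moment γ μ hγ hμ0 hμ1 (pochPoly γ m * fallPoly k) =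
      poch γ k * poch (γ + k) m * (-μ / (1 - μ)) ^ k * ∑' x, weight (γ + m) μ x := by
  have h := (hasSum_poch_neg_mul_weight hμ0 hμ1 k (by positivity : 0 < γ + m)).mul_left (poch γ m)
  have hp : poch γ k * poch (γ + k) m = poch γ m * poch (γ + m) k := by
    rw [← poch_add, ← poch_add, add_comm]
  rw [tsum_weight_add (by positivity : 0 < γ + m) hμ0 hμ1] at h
  rw [hp, div_pow]
  refine (tsum_congr fun x => ?_).trans (h.tsum_eq.trans (by ring))
  rw [eval_mul, eval_fallPoly, mul_right_comm, pochPoly_mul_weight]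
  ring

lemma sum_choose_mul_poch (n m : ℕ) (hm : m < n) :
    ∑ k ∈ range (n + 1), (-1 : ℝ) ^ k * n.choose k * poch (γ + k) m = 0 := by
  have h := congrFun (Polynomial.fwdDiff_iter_eq_zero_of_degree_lt
    (P := pochPoly γ m) (by rwa [natDegree_pochPoly])) 0
  rw [fwdDiff_iter_eq_sum_shift] at h
  have h2 := congrArg (fun t => (-1 : ℝ) ^ n * t) h
  simp only [Finset.mul_sum, Pi.zero_apply, mul_zero] at h2
  rw [← h2]
  refine Finset.sum_congr rfl fun k hk => ?_
  have hk : k ≤ n := Nat.lt_succ_iff.1 (mem_range.1 hk)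
  have hs : (-1 : ℝ) ^ n * (-1) ^ (n - k) = (-1) ^ k := by
    obtain ⟨d, rfl⟩ := Nat.exists_eq_add_of_le hk
    rw [Nat.add_sub_cancel_left, pow_add, mul_assoc, ← mul_pow]
    simp
  rw [zsmul_eq_mul, nsmul_one, zero_add, eval_pochPoly]
  push_cast
  rw [← hs]
  ring

lemma moment_meixnerPoly_mul (n : ℕ) (q : ℝ[X]) (hq : q.degree < (n : WithBot ℕ)) :
    moment γ μ hγ hμ0 hμ1 (meixnerPoly γ μ n * q) = 0 := by
  refine degree_lt_induction (pochPoly_monic γ) (natDegree_pochPoly γ) n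
    (p := fun q => moment γ μ hγ hμ0 hμ1 (meixnerPoly γ μ n * q) = 0) (by simp) ?_ q hq
  intro m hm c s _ hs
  have h1 : 1 - μ ≠ 0 := by linarith
  rw [mul_add, map_add, hs, add_zero, mul_left_comm, apply_C_mul, meixnerPoly, mul_assoc,
    apply_C_mul, Finset.sum_mul, map_sum]
  have : ∑ k ∈ range (n + 1), moment γ μ hγ hμ0 hμ1
      (C (poch (-(n : ℝ)) k / poch γ k * (1 - μ⁻¹) ^ k / (k.factorial : ℝ)) * fallPoly k *
        pochPoly γ m) = 0 := by
    rw [← zero_mul (∑' x, weight (γ + m) μ x), ← sum_choose_mul_poch (γ := γ) n m hm,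
      Finset.sum_mul]
    refine Finset.sum_congr rfl fun k hk => ?_
    have hk : k ≤ n := Nat.lt_succ_iff.1 (mem_range.1 hk)
    have hf : (k.factorial : ℝ) ≠ 0 := by exact_mod_cast k.factorial_ne_zero
    have hp := (poch_pos hγ k).ne'
    have hz : (1 - μ⁻¹) ^ k * (-μ / (1 - μ)) ^ k = 1 := by
      rw [← mul_pow, show (1 - μ⁻¹) * (-μ / (1 - μ)) = 1 by field_simp; ring, one_pow]
    rw [mul_assoc, apply_C_mul, mul_comm (fallPoly k), moment_pochPoly_mul_fallPoly,
      poch_neg_natCast n k hk]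
    generalize (1 - μ⁻¹) ^ k = u at *
    generalize (-μ / (1 - μ)) ^ k = v at *
    field_simp
    linear_combination (n.choose k : ℝ) * poch (γ + k) m * (∑' x, weight (γ + m) μ x) * hz
  rw [this, mul_zero, mul_zero]

end Meixner

section Sobolev

variable {γ μ lam α : ℝ} {i j : ℕ}

/-- The connection formula `Q_n = A_{1,n} M_n + B_{1,n} M_{n-1}`. -/
lemma sobolev_connection (hγ : 0 < γ) (hμ0 : 0 < μ) (hμ1 : μ < 1) (hlam : 0 < lam) (n : ℕ)
    {Q : ℝ[X]} (hQ : IsSobolevOP γ μ lam α i j (n + 1) Q) {x : ℝ}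
    (hbr : br i (x - α) (j + 1) ≠ 0) :
    Q.eval x = A1 γ μ lam α i j (n + 1) x * MeixnerM γ μ (n + 1) x +
      B1 γ μ lam α i j (n + 1) x * MeixnerM γ μ n x := by
  obtain ⟨hQm, hQd, hQo⟩ := hQ
  set ℓ := moment γ μ hγ hμ0 hμ1 with hℓ
  set P := meixnerPoly γ μ with hPdef
  set δ := diffFunctional i j α with hδ
  have hpos : ∀ p : ℝ[X], p ≠ 0 → 0 < ℓ (p * p) := moment_pos hγ hμ0 hμ1
  have hP : ∀ n, (P n).Monic := meixnerPoly_monic hγ hμ0 hμ1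
  have hd : ∀ n, (P n).natDegree = n := natDegree_meixnerPoly hγ hμ0 hμ1
  have hort : ∀ (n : ℕ) (q : ℝ[X]), q.degree < (n : WithBot ℕ) → ℓ (P n * q) = 0 :=
    moment_meixnerPoly_mul hγ hμ0 hμ1
  have hev : ∀ n, (fun x => (P n).eval x) = MeixnerM γ μ n := fun n => funext (eval_meixnerPoly n)
  have hN : ∀ n, ℓ (P n * P n) = nrm2 γ μ n := fun n => by
    rw [hℓ, moment_mul, hev]; rfl
  have hD : ∀ k, δ (P k) = Dk i j (MeixnerM γ μ k) α := fun k => by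
    rw [← hev]; rfl
  have hNpos : ∀ n, 0 < nrm2 γ μ n := fun n => hN n ▸ hpos _ (hP n).ne_zero
  have hNn := (hNpos n).ne'
  have hK : 0 ≤ Klm γ μ i j j n α α :=
    Finset.sum_nonneg fun k _ => div_nonneg (mul_self_nonneg _) (hNpos k).le
  have hden : 1 + lam * Klm γ μ i j j n α α ≠ 0 := by positivity
  -- the difference `G = Q - P (n + 1)` is represented by the kernel
  have hG : (Q - P (n + 1)).degree < ((n + 1 : ℕ) : WithBot ℕ) := by
    have h := degree_sub_lt_left (p := Q) (q := P (n + 1))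
      (by rw [degree_eq_natDegree hQm.ne_zero, degree_eq_natDegree (hP _).ne_zero, hQd, hd])
      hQm.ne_zero (by rw [hQm.leadingCoeff, (hP _).leadingCoeff])
    rwa [degree_eq_natDegree hQm.ne_zero, hQd] at h
  have hGp : ∀ p : ℝ[X], p.degree < ((n + 1 : ℕ) : WithBot ℕ) →
      ℓ (p * (Q - P (n + 1))) = -(lam * δ Q * δ p) := by
    intro p hp
    have h1 : ℓ (Q * p) + lam * δ Q * δ p = 0 := by
      rw [hℓ, moment_mul]; exact hQo p hp
    have h2 := hort (n + 1) p hp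
    rw [mul_sub, map_sub, mul_comm p Q, mul_comm p, h2]
    linarith
  have hexp : ∀ φ : ℝ[X] →ₗ[ℝ] ℝ, φ Q - φ (P (n + 1)) =
      -(lam * δ Q) * ∑ k ∈ range (n + 1), φ (P k) * δ (P k) / nrm2 γ μ k := by
    intro φ
    rw [← map_sub, ← sum_apply_mul_eq hpos hP hd hort φ (n + 1) _ hG, Finset.mul_sum]
    refine Finset.sum_congr rfl fun k hk => ?_
    rw [hGp, hN]
    · ring
    · rw [degree_eq_natDegree (hP k).ne_zero, hd]
      exact WithBot.coe_lt_coe.2 (mem_range.1 hk)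
  have hδQ : δ Q * (1 + lam * Klm γ μ i j j n α α) = Dk i j (MeixnerM γ μ (n + 1)) α := by
    have h := hexp δ
    simp only [hD] at h
    rw [Klm]
    linarith
  have hQx : Q.eval x = MeixnerM γ μ (n + 1) x
      - lam * δ Q * δ (kernelPoly ℓ P (n + 1) x) := by
    have h := hexp (leval x)
    have hk : δ (kernelPoly ℓ P (n + 1) x) =
        ∑ k ∈ range (n + 1), (P k).eval x * δ (P k) / nrm2 γ μ k := by
      rw [kernelPoly, map_sum]
      refine Finset.sum_congr rfl fun k _ => ?_
      rw [apply_C_mul, hN]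
      ring
    simp only [leval_apply] at h
    rw [hk, ← eval_meixnerPoly]
    linarith
  have hcd : (fun y => (x - y) * (kernelPoly ℓ P (n + 1) x).eval y) =
      ((nrm2 γ μ n)⁻¹ * MeixnerM γ μ (n + 1) x) • MeixnerM γ μ n +
        (-((nrm2 γ μ n)⁻¹ * MeixnerM γ μ n x)) • MeixnerM γ μ (n + 1) := by
    funext y
    have h := congrArg (Polynomial.eval y) (christoffel_darboux hpos hP hd hort n x)
    simp only [eval_mul, eval_sub, eval_C, eval_X, hN] at h
    rw [h]
    simp only [hPdef, eval_meixnerPoly, Pi.add_apply, Pi.smul_apply, smul_eq_mul]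
    ring
  have hkey : br i (x - α) (j + 1) * δ (kernelPoly ℓ P (n + 1) x) =
      (j.factorial : ℝ) * ∑ k ∈ range (j + 1), br i (x - α) k / (k.factorial : ℝ) *
        ((nrm2 γ μ n)⁻¹ * MeixnerM γ μ (n + 1) x * Dk i k (MeixnerM γ μ n) α
          - (nrm2 γ μ n)⁻¹ * MeixnerM γ μ n x * Dk i k (MeixnerM γ μ (n + 1)) α) := by
    refine (br_mul_Dk x α _ j).trans ?_
    rw [hcd]
    congr 1
    refine Finset.sum_congr rfl fun k _ => ?_
    rw [Dk_add, Dk_smul, Dk_smul]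
    simp only [Pi.add_apply, Pi.smul_apply, smul_eq_mul]
    ring
  have hsum : A1 γ μ lam α i j (n + 1) x * MeixnerM γ μ (n + 1) x +
      B1 γ μ lam α i j (n + 1) x * MeixnerM γ μ n x = MeixnerM γ μ (n + 1) x
        - lam * δ Q * (1 / br i (x - α) (j + 1) *
          (br i (x - α) (j + 1) * δ (kernelPoly ℓ P (n + 1) x))) := by
    rw [hkey, A1, B1, add_mul, one_mul, add_assoc, sub_eq_add_neg (MeixnerM γ μ (n + 1) x)]
    congr 1
    rw [mul_assoc, mul_assoc, ← mul_add, mul_left_comm _ (1 / br i (x - α) (j + 1)), ← mul_neg]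
    congr 1
    rw [← mul_assoc, Finset.sum_mul, Finset.sum_mul, ← Finset.sum_add_distrib, Finset.mul_sum,
      ← Finset.sum_neg_distrib]
    refine Finset.sum_congr rfl fun k _ => ?_
    have hk : (k.factorial : ℝ) ≠ 0 := by exact_mod_cast k.factorial_ne_zero
    rw [acoef, bcoef, Nat.add_sub_cancel, ← hδQ]
    field_simp
    ring
  rw [hsum, hQx]
  field_simp

end Sobolev

section Hypergeometric

variable {γ μ : ℝ}

lemma poch_shift_div (f : ℝ) (n k : ℕ) (hk : k ≤ n) (hf : ∀ m < n, f - 1 + (m : ℝ) ≠ 0)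
    (h1 : f - 1 ≠ 0) : poch f k / poch (f - 1) k = (f - 1 + k) / (f - 1) := by
  have hne : poch (f - 1) k ≠ 0 :=
    Finset.prod_ne_zero_iff.2 fun m hm => hf m ((mem_range.1 hm).trans_le hk)
  rw [div_eq_div_iff hne h1]
  have h := (poch_succ' (f - 1) k).symm.trans (poch_succ (f - 1) k)
  rw [sub_add_cancel] at h
  linarith

lemma MeixnerM_pred (n : ℕ) (x : ℝ) :
    MeixnerM γ μ n x = poch γ n * (μ / (μ - 1)) ^ n *
      ∑ k ∈ range (n + 2), (((n : ℝ) + 1 - k) / (n + 1)) *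
        (poch (-((n + 1 : ℕ) : ℝ)) k * poch (-x) k / poch γ k * (1 - μ⁻¹) ^ k /
          (k.factorial : ℝ)) := by
  rw [MeixnerM, Finset.sum_range_succ _ (n + 1)]
  push_cast
  rw [sub_self, zero_div, zero_mul, add_zero]
  congr 1
  refine Finset.sum_congr rfl fun k _ => ?_
  have hn : (n : ℝ) + 1 ≠ 0 := by positivity
  have h := (poch_succ' (-((n : ℝ) + 1)) k).symm.trans (poch_succ (-((n : ℝ) + 1)) k)
  rw [show -((n : ℝ) + 1) + 1 = -n by ring] at h
  have h' : poch (-(n : ℝ)) k = ((n : ℝ) + 1 - k) / (n + 1) * poch (-((n : ℝ) + 1)) k := by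
    field_simp
    linarith
  rw [h']
  ring

end Hypergeometric

end MeixnerSobolev

/-- hypergeometric representation of `Q_n^{(i)}(x)`. -/
theorem sobolev_hypergeometric_representation (γ μ lam α : ℝ) (hγ : 0 < γ) (hμ0 : 0 < μ)
    (hμ1 : μ < 1) (hlam : 0 < lam) (hα : α ≤ 0) (j i n : ℕ) (hi : i = 1 ∨ i = 2)
    (hn : 1 ≤ n) (Q : Polynomial ℝ) (hQ : IsSobolevOP γ μ lam α i j n Q) (x : ℝ)
    (hbr : br i (x - α) (j + 1) ≠ 0) (hB : B1 γ μ lam α i j n x ≠ 0)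
    (hf : ∀ m : ℕ, m ≤ n - 1 →
      ((n : ℝ) * μ * (γ + (n : ℝ) - 1) * A1 γ μ lam α i j n x /
          ((1 - μ) * B1 γ μ lam α i j n x) - (n : ℝ) + 1) - 1 + (m : ℝ) ≠ 0) :
    Q.eval x =
      poch γ (n - 1) * (μ / (μ - 1)) ^ (n - 1) *
        (-(μ * (γ + (n : ℝ) - 1) * A1 γ μ lam α i j n x / (1 - μ) -
            B1 γ μ lam α i j n x)) *
        ∑ k ∈ Finset.range (n + 1),
          poch (-(n : ℝ)) k * poch (-x) k *
            poch ((n : ℝ) * μ * (γ + (n : ℝ) - 1) * A1 γ μ lam α i j n x /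
                ((1 - μ) * B1 γ μ lam α i j n x) - (n : ℝ) + 1) k /
            (poch γ k *
              poch (((n : ℝ) * μ * (γ + (n : ℝ) - 1) * A1 γ μ lam α i j n x /
                  ((1 - μ) * B1 γ μ lam α i j n x) - (n : ℝ) + 1) - 1) k) *
            (1 - μ⁻¹) ^ k / (Nat.factorial k : ℝ) := by
  obtain ⟨n, rfl⟩ := Nat.exists_eq_succ_of_ne_zero (Nat.one_le_iff_ne_zero.1 hn)
  rw [Nat.succ_eq_add_one] at *
  rw [MeixnerSobolev.sobolev_connection hγ hμ0 hμ1 hlam n hQ hbr, MeixnerSobolev.MeixnerM_pred n x,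
    MeixnerM]
  simp only [Nat.add_sub_cancel] at hf ⊢
  generalize A1 γ μ lam α i j (n + 1) x = A at *
  generalize B1 γ μ lam α i j (n + 1) x = B at *
  have hμ : 1 - μ ≠ 0 := by linarith
  have hμ' : μ - 1 ≠ 0 := by linarith
  have hn1 : ((n + 1 : ℕ) : ℝ) ≠ 0 := by positivity
  have hf0 := hf 0 (Nat.zero_le n)
  rw [Nat.cast_zero, add_zero] at hf0
  have hfB : -(μ * (γ + ((n + 1 : ℕ) : ℝ) - 1) * A / (1 - μ) - B) * ((n + 1 : ℕ) : ℝ) =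
      -B * (((n + 1 : ℕ) : ℝ) * μ * (γ + ((n + 1 : ℕ) : ℝ) - 1) * A / ((1 - μ) * B)
        - ((n + 1 : ℕ) : ℝ) + 1 - 1) := by
    field_simp
    ring
  generalize ((n + 1 : ℕ) : ℝ) * μ * (γ + ((n + 1 : ℕ) : ℝ) - 1) * A / ((1 - μ) * B)
        - ((n + 1 : ℕ) : ℝ) + 1 = f at *
  have hh : ∀ k ≤ n + 1, -(μ * (γ + ((n + 1 : ℕ) : ℝ) - 1) * A / (1 - μ) - B) *
      (poch f k / poch (f - 1) k) =
        A * (γ + n) * (μ / (μ - 1)) + B * (((n : ℝ) + 1 - k) / (n + 1)) := by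
    intro k hk
    have hc : μ / (1 - μ) = -(μ / (μ - 1)) := by
      field_simp
      ring
    rw [MeixnerSobolev.poch_shift_div f (n + 1) k hk (fun m hm => hf m (by omega)) hf0]
    have hc' : -(μ * (γ + ((n + 1 : ℕ) : ℝ) - 1) * A / (1 - μ) - B) =
        A * (γ + n) * (μ / (μ - 1)) + B := by
      push_cast
      linear_combination -((γ + n) * A) * hc
    rw [hc'] at hfB ⊢
    generalize A * (γ + n) * (μ / (μ - 1)) = t at *
    push_cast at hfB hn1
    field_simp
    linear_combination (k : ℝ) * hfB
  rw [MeixnerSobolev.poch_succ, pow_succ, ← mul_assoc A, ← mul_assoc B, Finset.mul_sum,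
    Finset.mul_sum, Finset.mul_sum, ← Finset.sum_add_distrib]
  refine Finset.sum_congr rfl fun k hk => ?_
  have h := hh k (Nat.lt_succ_iff.1 (mem_range.1 hk))
  linear_combination -(poch γ n * (μ / (μ - 1)) ^ n * (poch (-((n + 1 : ℕ) : ℝ)) k * poch (-x) k /
    poch γ k * (1 - μ⁻¹) ^ k / (k.factorial : ℝ))) * h
end
end

section
/- Let n ≥ 2 be an integer and i ∈ {1,2}. For every real x with ⟨x−α⟩_i^{j+1} ≠ 0 (so that the rational functions involved are defined), Q_{n−1}^{(i)}(x) = A_{2,n}(x) M_n(x) + B_{2,n}(x) M_{n−1}(x). -/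
open Finset Filter Topology Polynomial

noncomputable section

section DifferenceOperators

/-- The sign of the shift underlying `𝒟_i`. -/
def shiftSign (i : ℕ) : ℝ := if i = 1 then 1 else -1

lemma shiftSign_mul_self (i : ℕ) : shiftSign i * shiftSign i = 1 := by
  unfold shiftSign; split_ifs <;> norm_num

lemma Dop_apply (i : ℕ) (f : ℝ → ℝ) (x : ℝ) :
    Dop i f x = shiftSign i * (f (x + shiftSign i) - f x) := by
  unfold Dop shiftSign
  split_ifs
  · ring
  · rw [← sub_eq_add_neg]; ring

lemma br_zero (i : ℕ) (x : ℝ) : br i x 0 = 1 := by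
  simp [br, fall, poch]

lemma br_succ (i : ℕ) (x : ℝ) (k : ℕ) :
    br i x (k + 1) = br i x k * (x - shiftSign i * k) := by
  unfold br shiftSign fall poch
  split_ifs <;> rw [Finset.prod_range_succ] <;> ring

lemma Dk_zero (i : ℕ) (f : ℝ → ℝ) : Dk i 0 f = f := rfl

lemma Dk_succ (i k : ℕ) (f : ℝ → ℝ) : Dk i (k + 1) f = Dop i (Dk i k f) :=
  Function.iterate_succ_apply' _ _ _

/-- The iterated difference operator as a linear map. -/
def DkLin (i k : ℕ) : (ℝ → ℝ) →ₗ[ℝ] (ℝ → ℝ) where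
  toFun := Dk i k
  map_add' f g := by
    induction k with
    | zero => rfl
    | succ k ih =>
      simp only [Dk_succ, ih]
      ext x
      simp only [Dop_apply, Pi.add_apply]
      ring
  map_smul' c f := by
    induction k with
    | zero => rfl
    | succ k ih =>
      simp only [Dk_succ, ih, RingHom.id_apply]
      ext x
      simp only [Dop_apply, Pi.smul_apply, smul_eq_mul]
      ring

lemma DkLin_apply (i k : ℕ) (f : ℝ → ℝ) : DkLin i k f = Dk i k f := rfl

lemma Dk_sum_mul (i k N : ℕ) (c : ℕ → ℝ) (f : ℕ → ℝ → ℝ) (y : ℝ) :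
    Dk i k (fun z => ∑ m ∈ Finset.range N, c m * f m z) y =
      ∑ m ∈ Finset.range N, c m * Dk i k (f m) y := by
  have h : (fun z => ∑ m ∈ Finset.range N, c m * f m z) =
      ∑ m ∈ Finset.range N, c m • f m := by
    ext z; simp
  rw [h, ← DkLin_apply, map_sum]
  simp [DkLin_apply]

lemma Dk_add_mul (i k : ℕ) (a b : ℝ) (f g : ℝ → ℝ) (y : ℝ) :
    Dk i k (fun z => a * f z + b * g z) y = a * Dk i k f y + b * Dk i k g y := by
  have h : (fun z => a * f z + b * g z) = a • f + b • g := by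
    ext z; simp
  rw [h, ← DkLin_apply, map_add, map_smul, map_smul]
  simp [DkLin_apply]

lemma Dk_succ_sub_mul (i k : ℕ) (x : ℝ) (g : ℝ → ℝ) (y : ℝ) :
    Dk i (k + 1) (fun z => (x - z) * g z) y =
      (x - y - shiftSign i * (k + 1)) * Dk i (k + 1) g y - (k + 1) * Dk i k g y := by
  induction k generalizing y with
  | zero =>
    simp only [Dk_succ, Dop_apply, Dk_zero]
    push_cast
    linear_combination -(g y) * shiftSign_mul_self i
  | succ k ih =>
    rw [Dk_succ i (k + 1), Dop_apply, ih, ih, Dk_succ i (k + 1) g, Dop_apply]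
    have h : ∀ z, Dk i (k + 1) g z = shiftSign i * (Dk i k g (z + shiftSign i) - Dk i k g z) :=
      fun z => by rw [Dk_succ, Dop_apply]
    have h1 := h y
    have hs := shiftSign_mul_self i
    push_cast
    generalize Dk i (k + 1) g y = a at *
    generalize Dk i (k + 1) g (y + shiftSign i) = b at *
    linear_combination (k + 1 : ℝ) * h1 - a * hs

/-- Iterated difference of a quotient `F(y) / (x - y)`, with denominators cleared. -/
lemma br_mul_Dk (i j : ℕ) (x α : ℝ) (g : ℝ → ℝ) :
    br i (x - α) (j + 1) * Dk i j g α =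
      ∑ k ∈ Finset.range (j + 1), (j.factorial : ℝ) / k.factorial * br i (x - α) k *
        Dk i k (fun z => (x - z) * g z) α := by
  induction j with
  | zero => simp [br_succ, br_zero, Dk]
  | succ j ih =>
    have hsum : ∑ k ∈ Finset.range (j + 1), ((j + 1).factorial : ℝ) / k.factorial *
        br i (x - α) k * Dk i k (fun z => (x - z) * g z) α =
        (j + 1) * (br i (x - α) (j + 1) * Dk i j g α) := by
      rw [ih, Finset.mul_sum]
      refine Finset.sum_congr rfl fun k _ => ?_
      rw [Nat.factorial_succ]; push_cast; ring
    rw [Finset.sum_range_succ, hsum, Dk_succ_sub_mul, div_self (by positivity),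
      br_succ i _ (j + 1)]
    push_cast
    ring

end DifferenceOperators

section Pochhammer

lemma poch_succ (a : ℝ) (k : ℕ) : poch a (k + 1) = poch a k * (a + k) :=
  Finset.prod_range_succ _ _

lemma poch_succ' (a : ℝ) (k : ℕ) : poch a (k + 1) = a * poch (a + 1) k := by
  unfold poch
  rw [Finset.prod_range_succ', mul_comm]
  congr 1
  · simp
  · refine Finset.prod_congr rfl fun m _ => ?_
    push_cast; ring

lemma poch_zero (a : ℝ) : poch a 0 = 1 := rfl

lemma poch_pos {a : ℝ} (ha : 0 < a) (k : ℕ) : 0 < poch a k :=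
  Finset.prod_pos fun m _ => by positivity

lemma poch_neg_eq_zero {n k : ℕ} (h : n < k) : poch (-(n : ℝ)) k = 0 :=
  Finset.prod_eq_zero (Finset.mem_range.2 h) (by simp)

lemma sum_poch_div_factorial (a : ℝ) (m : ℕ) :
    ∑ k ∈ Finset.range (m + 1), poch a k / (k.factorial : ℝ) =
      poch (a + 1) m / (m.factorial : ℝ) := by
  induction m with
  | zero => simp [poch_zero]
  | succ m ih =>
    rw [Finset.sum_range_succ, ih, poch_succ' a, poch_succ, Nat.factorial_succ]
    push_cast
    have : (m.factorial : ℝ) ≠ 0 := by positivity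
    field_simp
    ring

end Pochhammer

section MeixnerPolynomials

/-- Coefficient of `(-x)_k` in the Meixner polynomial of degree `n`. -/
def meixnerCoeff (γ μ : ℝ) (n k : ℕ) : ℝ :=
  poch γ n * (μ / (μ - 1)) ^ n * (poch (-(n : ℝ)) k / poch γ k * (1 - μ⁻¹) ^ k / k.factorial)

lemma MeixnerM_eq_sum (γ μ : ℝ) {n N : ℕ} (h : n < N) (x : ℝ) :
    MeixnerM γ μ n x = ∑ k ∈ Finset.range N, meixnerCoeff γ μ n k * poch (-x) k := by
  unfold MeixnerM
  rw [Finset.mul_sum, ← Finset.sum_subset (Finset.range_mono (Nat.succ_le_of_lt h))]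
  · refine Finset.sum_congr rfl fun k _ => ?_
    unfold meixnerCoeff; ring
  · intro k _ hk
    have : n < k := by simpa using hk
    simp [meixnerCoeff, poch_neg_eq_zero this]

lemma meixnerCoeff_recurrence_zero (γ : ℝ) {μ : ℝ} (hμ1 : μ < 1) (n : ℕ) :
    meixnerCoeff γ μ (n + 2) 0 + alphaR γ μ (n + 1) * meixnerCoeff γ μ (n + 1) 0 +
      betaR γ μ (n + 1) * meixnerCoeff γ μ n 0 = 0 := by
  have h1 : μ - 1 ≠ 0 := by linarith
  have e : 1 - μ = -(μ - 1) := by ring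
  simp only [meixnerCoeff, alphaR, betaR, poch_zero, poch_succ γ, e]
  push_cast
  simp only [pow_succ]
  field_simp
  ring

lemma meixnerCoeff_recurrence_one {γ μ : ℝ} (hγ : 0 < γ) (hμ0 : 0 < μ) (hμ1 : μ < 1) (n : ℕ) :
    meixnerCoeff γ μ (n + 2) 1 + alphaR γ μ (n + 1) * meixnerCoeff γ μ (n + 1) 1 +
      betaR γ μ (n + 1) * meixnerCoeff γ μ n 1 =
      meixnerCoeff γ μ (n + 1) 1 - meixnerCoeff γ μ (n + 1) 0 := by
  have h1 : μ - 1 ≠ 0 := by linarith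
  have h2 : 1 - μ ≠ 0 := by linarith
  have e : 1 - μ = -(μ - 1) := by ring
  simp only [meixnerCoeff, alphaR, betaR, poch_zero, poch_succ, e]
  push_cast
  simp only [pow_succ]
  simp
  field_simp
  ring

lemma meixnerCoeff_recurrence {γ μ : ℝ} (hγ : 0 < γ) (hμ0 : 0 < μ) (hμ1 : μ < 1) (n k : ℕ) :
    meixnerCoeff γ μ (n + 2) (k + 1) + alphaR γ μ (n + 1) * meixnerCoeff γ μ (n + 1) (k + 1) +
      betaR γ μ (n + 1) * meixnerCoeff γ μ n (k + 1) =
      (k + 1) * meixnerCoeff γ μ (n + 1) (k + 1) - meixnerCoeff γ μ (n + 1) k := by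
  rcases k with _ | l
  · simpa using meixnerCoeff_recurrence_one hγ hμ0 hμ1 n
  have h1 : μ - 1 ≠ 0 := by linarith
  have e : 1 - μ = -(μ - 1) := by ring
  have p1 := (poch_pos hγ l).ne'
  have p2 : γ + l ≠ 0 := by positivity
  have p3 : γ + (l + 1) ≠ 0 := by positivity
  have f1 : (l.factorial : ℝ) ≠ 0 := by positivity
  have e1 : poch (-((n + 2 : ℕ) : ℝ)) (l + 2) = (n + 2) * (n + 1) * poch (-(n : ℝ)) l := by
    rw [poch_succ', poch_succ', show -((n + 2 : ℕ) : ℝ) + 1 + 1 = -n by push_cast; ring]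
    push_cast; ring
  have e2 (m : ℕ) : poch (-((n + 1 : ℕ) : ℝ)) (m + 1) = -(n + 1) * poch (-(n : ℝ)) m := by
    rw [poch_succ', show -((n + 1 : ℕ) : ℝ) + 1 = -n by push_cast; ring]
    push_cast; ring
  have hμ : 1 - μ⁻¹ = (μ - 1) / μ := by field_simp
  simp only [meixnerCoeff, alphaR, betaR, e1, e2, poch_succ, e, hμ, Nat.factorial_succ]
  push_cast
  simp only [pow_succ]
  field_simp
  ring

lemma MeixnerM_recurrence {γ μ : ℝ} (hγ : 0 < γ) (hμ0 : 0 < μ) (hμ1 : μ < 1) (n : ℕ) (x : ℝ) :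
    MeixnerM γ μ (n + 2) x =
      (x - alphaR γ μ (n + 1)) * MeixnerM γ μ (n + 1) x - betaR γ μ (n + 1) * MeixnerM γ μ n x := by
  have hx : x * MeixnerM γ μ (n + 1) x = ∑ k ∈ Finset.range (n + 3),
      (k * meixnerCoeff γ μ (n + 1) k * poch (-x) k -
        meixnerCoeff γ μ (n + 1) k * poch (-x) (k + 1)) := by
    rw [MeixnerM_eq_sum γ μ (show n + 1 < n + 3 by omega), Finset.mul_sum]
    refine Finset.sum_congr rfl fun k _ => ?_
    rw [poch_succ]; ring
  have hlast : meixnerCoeff γ μ (n + 1) (n + 2) = 0 := by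
    rw [meixnerCoeff, poch_neg_eq_zero (show n + 1 < n + 2 by omega)]; simp
  have hx' : x * MeixnerM γ μ (n + 1) x = ∑ k ∈ Finset.range (n + 2),
      ((k + 1) * meixnerCoeff γ μ (n + 1) (k + 1) - meixnerCoeff γ μ (n + 1) k) *
        poch (-x) (k + 1) := by
    rw [hx, Finset.sum_sub_distrib, Finset.sum_range_succ', Finset.sum_range_succ _ (n + 2), hlast]
    simp only [sub_mul, Finset.sum_sub_distrib]
    push_cast
    ring
  have key : MeixnerM γ μ (n + 2) x + alphaR γ μ (n + 1) * MeixnerM γ μ (n + 1) x +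
      betaR γ μ (n + 1) * MeixnerM γ μ n x = x * MeixnerM γ μ (n + 1) x := by
    rw [hx', MeixnerM_eq_sum γ μ (show n + 2 < n + 3 by omega),
      MeixnerM_eq_sum γ μ (show n + 1 < n + 3 by omega),
      MeixnerM_eq_sum γ μ (show n < n + 3 by omega), Finset.mul_sum, Finset.mul_sum,
      ← Finset.sum_add_distrib, ← Finset.sum_add_distrib, Finset.sum_range_succ']
    have h0 := meixnerCoeff_recurrence_zero γ hμ1 n
    rw [poch_zero]
    simp only [← meixnerCoeff_recurrence hγ hμ0 hμ1]
    rw [add_eq_left.2 (by linear_combination h0)]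
    refine Finset.sum_congr rfl fun k _ => ?_
    ring
  linear_combination key

/-- The monic Meixner polynomials, defined by their three-term recurrence. -/
def meixnerPoly (γ μ : ℝ) : ℕ → ℝ[X]
  | 0 => 1
  | 1 => X - C (alphaR γ μ 0)
  | n + 2 => (X - C (alphaR γ μ (n + 1))) * meixnerPoly γ μ (n + 1) -
      C (betaR γ μ (n + 1)) * meixnerPoly γ μ n

lemma eval_meixnerPoly {γ μ : ℝ} (hγ : 0 < γ) (hμ0 : 0 < μ) (hμ1 : μ < 1) (n : ℕ) (x : ℝ) :
    (meixnerPoly γ μ n).eval x = MeixnerM γ μ n x := by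
  induction n using Nat.twoStepInduction with
  | zero => simp [meixnerPoly, MeixnerM, poch_zero]
  | one =>
    have h1 : μ - 1 ≠ 0 := by linarith
    have e : 1 - μ = -(μ - 1) := by ring
    have hμ : 1 - μ⁻¹ = (μ - 1) / μ := by field_simp
    simp [meixnerPoly, MeixnerM, Finset.sum_range_succ, poch_zero, poch_succ, alphaR]
    rw [hμ, e]
    field_simp
    ring
  | more n ih1 ih2 =>
    simp [meixnerPoly, ih1, ih2, MeixnerM_recurrence hγ hμ0 hμ1]

lemma meixnerPoly_succ (γ μ : ℝ) (n : ℕ) :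
    X * meixnerPoly γ μ n = meixnerPoly γ μ (n + 1) + C (alphaR γ μ n) * meixnerPoly γ μ n +
      C (betaR γ μ n) * meixnerPoly γ μ (n - 1) := by
  cases n with
  | zero => simp [meixnerPoly, betaR]
  | succ n => simp only [meixnerPoly, Nat.add_sub_cancel]; ring

lemma meixnerPoly_monic_natDegree (γ μ : ℝ) (n : ℕ) :
    (meixnerPoly γ μ n).Monic ∧ (meixnerPoly γ μ n).natDegree = n := by
  induction n using Nat.twoStepInduction with
  | zero => simp [meixnerPoly]
  | one => exact ⟨monic_X_sub_C _, natDegree_X_sub_C _⟩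
  | more n ih1 ih2 =>
    have hm : ((X - C (alphaR γ μ (n + 1))) * meixnerPoly γ μ (n + 1)).Monic :=
      (monic_X_sub_C _).mul ih2.1
    have hd : ((X - C (alphaR γ μ (n + 1))) * meixnerPoly γ μ (n + 1)).natDegree = n + 2 := by
      rw [(monic_X_sub_C _).natDegree_mul ih2.1, natDegree_X_sub_C, ih2.2]; ring
    have hlt : (C (betaR γ μ (n + 1)) * meixnerPoly γ μ n).degree <
        ((X - C (alphaR γ μ (n + 1))) * meixnerPoly γ μ (n + 1)).degree := by
      rw [← smul_eq_C_mul]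
      refine (degree_smul_le _ _).trans_lt ?_
      rw [degree_eq_natDegree ih1.1.ne_zero, degree_eq_natDegree hm.ne_zero, ih1.2, hd]
      exact_mod_cast (by omega : n < n + 2)
    exact ⟨hm.sub_of_left hlt, by
      rw [meixnerPoly, natDegree_eq_of_degree_eq (degree_sub_eq_left_of_degree_lt hlt), hd]⟩

lemma degree_meixnerPoly (γ μ : ℝ) (n : ℕ) : (meixnerPoly γ μ n).degree = n := by
  rw [degree_eq_natDegree (meixnerPoly_monic_natDegree γ μ n).1.ne_zero,
    (meixnerPoly_monic_natDegree γ μ n).2]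

lemma exists_eq_sum_meixnerPoly (γ μ : ℝ) (N : ℕ) (p : ℝ[X]) (hp : p.degree < N) :
    ∃ d : ℕ → ℝ, p = ∑ k ∈ Finset.range N, C (d k) * meixnerPoly γ μ k := by
  induction N generalizing p with
  | zero => exact ⟨0, by simpa using hp⟩
  | succ N ih =>
    have hM := meixnerPoly_monic_natDegree γ μ N
    have hlt : (p - C (p.coeff N) * meixnerPoly γ μ N).degree < N := by
      rw [degree_lt_iff_coeff_zero] at hp ⊢
      intro m hm
      rcases hm.eq_or_lt with rfl | h
      · have : (meixnerPoly γ μ N).coeff N = 1 := by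
          have := hM.1.coeff_natDegree
          rwa [hM.2] at this
        simp [this]
      · rw [coeff_sub, coeff_C_mul, hp m h,
          coeff_eq_zero_of_natDegree_lt (p := meixnerPoly γ μ N) (by rwa [hM.2])]
        simp
    obtain ⟨d, hd⟩ := ih _ hlt
    refine ⟨Function.update d N (p.coeff N), ?_⟩
    rw [Finset.sum_range_succ, Function.update_self]
    have : ∑ k ∈ Finset.range N, C (Function.update d N (p.coeff N) k) * meixnerPoly γ μ k =
        ∑ k ∈ Finset.range N, C (d k) * meixnerPoly γ μ k := by
      refine Finset.sum_congr rfl fun k hk => ?_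
      rw [Function.update_of_ne (Finset.mem_range.1 hk).ne]
    rw [this, ← hd]
    ring

end MeixnerPolynomials

section Functional

/-- The Meixner weight at a natural number. -/
def meixnerWeight (γ μ : ℝ) (x : ℕ) : ℝ := μ ^ x * poch γ x / x.factorial

lemma meixnerWeight_pos {γ μ : ℝ} (hγ : 0 < γ) (hμ0 : 0 < μ) (x : ℕ) :
    0 < meixnerWeight γ μ x := by
  have := poch_pos hγ x
  unfold meixnerWeight
  positivity

lemma meixnerWeight_succ (γ μ : ℝ) (x : ℕ) :
    (x + 1) * meixnerWeight γ μ (x + 1) = μ * (x + γ) * meixnerWeight γ μ x := by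
  unfold meixnerWeight
  rw [poch_succ, Nat.factorial_succ]
  push_cast
  field_simp
  ring

lemma tendsto_natCast_add_div_add_one (a : ℝ) :
    Tendsto (fun x : ℕ => ((x : ℝ) + a) / (x + 1)) atTop (𝓝 1) := by
  have h := (tendsto_one_div_add_atTop_nhds_zero_nat (𝕜 := ℝ)).const_mul (a - 1)
  have h' := h.const_add 1
  rw [mul_zero, add_zero] at h'
  refine h'.congr fun x => ?_
  have : (x : ℝ) + 1 ≠ 0 := by positivity
  field_simp
  ring

lemma summable_pow_mul_meixnerWeight {γ μ : ℝ} (hγ : 0 < γ) (hμ0 : 0 < μ) (hμ1 : μ < 1)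
    (m : ℕ) : Summable fun x : ℕ => ((x : ℝ) + 1) ^ m * meixnerWeight γ μ x := by
  have hpos (x : ℕ) : 0 < ((x : ℝ) + 1) ^ m * meixnerWeight γ μ x :=
    mul_pos (by positivity) (meixnerWeight_pos hγ hμ0 x)
  refine summable_of_ratio_test_tendsto_lt_one hμ1 (.of_forall fun x => (hpos x).ne') ?_
  have h := ((tendsto_natCast_add_div_add_one 2).pow m).mul
    ((tendsto_natCast_add_div_add_one γ).const_mul μ)
  rw [one_pow, one_mul, mul_one] at h
  refine h.congr fun x => ?_
  rw [Real.norm_of_nonneg (hpos _).le, Real.norm_of_nonneg (hpos _).le]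
  have hw := (meixnerWeight_pos hγ hμ0 x).ne'
  have hx : (x : ℝ) + 1 ≠ 0 := by positivity
  have hs : meixnerWeight γ μ (x + 1) = μ * (x + γ) * meixnerWeight γ μ x / (x + 1) := by
    rw [← meixnerWeight_succ, mul_div_cancel_left₀ _ hx]
  rw [hs]
  push_cast
  rw [div_pow]
  field_simp
  ring

lemma summable_eval_mul_meixnerWeight {γ μ : ℝ} (hγ : 0 < γ) (hμ0 : 0 < μ) (hμ1 : μ < 1)
    (p : ℝ[X]) : Summable fun x : ℕ => p.eval (x : ℝ) * meixnerWeight γ μ x := by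
  induction p using Polynomial.induction_on' with
  | add p q hp hq => simpa [add_mul] using hp.add hq
  | monomial m a =>
    simp only [eval_monomial, mul_assoc]
    refine Summable.mul_left a ?_
    refine Summable.of_nonneg_of_le (fun x => ?_) (fun x => ?_)
      (summable_pow_mul_meixnerWeight hγ hμ0 hμ1 m)
    · have := meixnerWeight_pos hγ hμ0 x
      positivity
    · have := (meixnerWeight_pos hγ hμ0 x).le
      gcongr
      linarith

/-- The Meixner moment functional. -/
def meixnerFunctional {γ μ : ℝ} (hγ : 0 < γ) (hμ0 : 0 < μ) (hμ1 : μ < 1) : ℝ[X] →ₗ[ℝ] ℝ where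
  toFun p := ∑' x : ℕ, p.eval (x : ℝ) * meixnerWeight γ μ x
  map_add' p q := by
    simp only [eval_add, add_mul]
    exact (summable_eval_mul_meixnerWeight hγ hμ0 hμ1 p).tsum_add
      (summable_eval_mul_meixnerWeight hγ hμ0 hμ1 q)
  map_smul' c p := by
    simp only [eval_smul, smul_eq_mul, mul_assoc, RingHom.id_apply]
    exact tsum_mul_left

variable {γ μ : ℝ} (hγ : 0 < γ) (hμ0 : 0 < μ) (hμ1 : μ < 1)

lemma meixnerFunctional_C_mul (c : ℝ) (p : ℝ[X]) :
    meixnerFunctional hγ hμ0 hμ1 (C c * p) = c * meixnerFunctional hγ hμ0 hμ1 p := by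
  rw [← smul_eq_C_mul, map_smul, smul_eq_mul]

lemma mIP_eval (p q : ℝ[X]) :
    mIP γ μ (fun x => p.eval x) (fun x => q.eval x) = meixnerFunctional hγ hμ0 hμ1 (p * q) := by
  refine tsum_congr fun x => ?_
  simp only [eval_mul, meixnerWeight]
  ring

lemma meixnerFunctional_one_pos : 0 < meixnerFunctional hγ hμ0 hμ1 1 :=
  (summable_eval_mul_meixnerWeight hγ hμ0 hμ1 1).tsum_pos
    (fun x => by simpa using (meixnerWeight_pos hγ hμ0 x).le) 0
    (by simpa using meixnerWeight_pos hγ hμ0 0)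

/-- The Pearson equation of the Meixner weight. -/
lemma meixnerFunctional_X_mul (p : ℝ[X]) :
    meixnerFunctional hγ hμ0 hμ1 (X * p) =
      μ * meixnerFunctional hγ hμ0 hμ1 ((X + C γ) * p.comp (X + 1)) := by
  have hs := summable_eval_mul_meixnerWeight hγ hμ0 hμ1 (X * p)
  change ∑' x : ℕ, _ = μ * ∑' x : ℕ, _
  rw [hs.tsum_eq_zero_add, ← tsum_mul_left]
  simp only [eval_mul, eval_X, Nat.cast_zero, zero_mul, zero_add]
  refine tsum_congr fun x => ?_
  have h := meixnerWeight_succ γ μ x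
  simp only [eval_comp, eval_add, eval_X, eval_C, eval_one]
  push_cast
  linear_combination (p.eval ((x : ℝ) + 1)) * h

/-- The polynomial `(-x)_k`. -/
def negPochPoly (k : ℕ) : ℝ[X] := ∏ m ∈ Finset.range k, (-X + C (m : ℝ))

lemma eval_negPochPoly (k : ℕ) (x : ℝ) : (negPochPoly k).eval x = poch (-x) k := by
  simp [negPochPoly, poch, eval_prod]

lemma meixnerFunctional_negPochPoly_succ (k : ℕ) :
    (1 - μ) * meixnerFunctional hγ hμ0 hμ1 (negPochPoly (k + 1)) =
      -μ * (γ + k) * meixnerFunctional hγ hμ0 hμ1 (negPochPoly k) := by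
  have h1 : negPochPoly (k + 1) = X * (-(negPochPoly k).comp (X - 1)) := by
    refine Polynomial.funext fun x => ?_
    simp only [eval_mul, eval_X, eval_neg, eval_comp, eval_sub, eval_one, eval_negPochPoly,
      poch_succ', show -x + 1 = -(x - 1) by ring]
    ring
  have h2 : (X + C γ) * (-(negPochPoly k).comp (X - 1)).comp (X + 1) =
      negPochPoly (k + 1) - C (γ + k) * negPochPoly k := by
    refine Polynomial.funext fun x => ?_
    simp only [eval_mul, eval_X, eval_neg, eval_comp, eval_sub, eval_add, eval_C, eval_one,
      eval_negPochPoly, poch_succ, add_sub_cancel_right]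
    ring
  have h := meixnerFunctional_X_mul hγ hμ0 hμ1 (-(negPochPoly k).comp (X - 1))
  rw [← h1, h2, map_sub, meixnerFunctional_C_mul] at h
  linear_combination h

lemma meixnerFunctional_negPochPoly (k : ℕ) :
    meixnerFunctional hγ hμ0 hμ1 (negPochPoly k) =
      poch γ k * (μ / (μ - 1)) ^ k * meixnerFunctional hγ hμ0 hμ1 1 := by
  induction k with
  | zero => simp [negPochPoly, poch_zero]
  | succ k ih =>
    have h1 : μ - 1 ≠ 0 := by linarith
    have h := meixnerFunctional_negPochPoly_succ hγ hμ0 hμ1 k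
    rw [ih] at h
    rw [poch_succ, pow_succ]
    field_simp
    field_simp at h
    linear_combination -h

lemma meixnerFunctional_meixnerPoly (n : ℕ) :
    meixnerFunctional hγ hμ0 hμ1 (meixnerPoly γ μ (n + 1)) = 0 := by
  have h1 : μ - 1 ≠ 0 := by linarith
  have hsum : meixnerPoly γ μ (n + 1) =
      ∑ k ∈ Finset.range (n + 2), C (meixnerCoeff γ μ (n + 1) k) * negPochPoly k := by
    refine Polynomial.funext fun x => ?_
    rw [eval_meixnerPoly hγ hμ0 hμ1, MeixnerM_eq_sum γ μ (Nat.lt_succ_self (n + 1))]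
    simp [eval_finsetSum, eval_negPochPoly]
  have hterm (k : ℕ) : meixnerFunctional hγ hμ0 hμ1
      (C (meixnerCoeff γ μ (n + 1) k) * negPochPoly k) =
      poch γ (n + 1) * (μ / (μ - 1)) ^ (n + 1) * meixnerFunctional hγ hμ0 hμ1 1 *
        (poch (-((n + 1 : ℕ) : ℝ)) k / k.factorial) := by
    have hp := (poch_pos hγ k).ne'
    have hq : (1 - μ⁻¹) ^ k * (μ / (μ - 1)) ^ k = 1 := by
      rw [← mul_pow, show (1 - μ⁻¹) * (μ / (μ - 1)) = 1 by field_simp, one_pow]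
    rw [meixnerFunctional_C_mul, meixnerFunctional_negPochPoly, meixnerCoeff]
    calc _ = poch γ (n + 1) * (μ / (μ - 1)) ^ (n + 1) * meixnerFunctional hγ hμ0 hμ1 1 *
        (poch (-((n + 1 : ℕ) : ℝ)) k / k.factorial) * (poch γ k / poch γ k) *
          ((1 - μ⁻¹) ^ k * (μ / (μ - 1)) ^ k) := by ring
      _ = _ := by rw [hq, div_self hp, mul_one, mul_one]
  rw [hsum, map_sum]
  simp only [hterm]
  rw [← Finset.mul_sum, sum_poch_div_factorial,
    show -((n + 1 : ℕ) : ℝ) + 1 = -(n : ℝ) by push_cast; ring, poch_neg_eq_zero (Nat.lt_succ_self n)]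
  simp

lemma meixnerFunctional_X_pow_mul {k n : ℕ} (h : k < n) :
    meixnerFunctional hγ hμ0 hμ1 (X ^ k * meixnerPoly γ μ n) = 0 := by
  induction k generalizing n with
  | zero =>
    obtain ⟨m, rfl⟩ : ∃ m, n = m + 1 := ⟨n - 1, by omega⟩
    simpa using meixnerFunctional_meixnerPoly hγ hμ0 hμ1 m
  | succ k ih =>
    have e : X ^ (k + 1) * meixnerPoly γ μ n = X ^ k * meixnerPoly γ μ (n + 1) +
        C (alphaR γ μ n) * (X ^ k * meixnerPoly γ μ n) +
        C (betaR γ μ n) * (X ^ k * meixnerPoly γ μ (n - 1)) := by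
      rw [pow_succ, mul_assoc, meixnerPoly_succ]; ring
    rw [e, map_add, map_add, meixnerFunctional_C_mul, meixnerFunctional_C_mul,
      ih (by omega), ih (by omega), ih (by omega)]
    ring

lemma meixnerFunctional_mul_eq_zero {p : ℝ[X]} {n : ℕ} (hp : p.degree < n) :
    meixnerFunctional hγ hμ0 hμ1 (p * meixnerPoly γ μ n) = 0 := by
  by_cases h0 : p = 0
  · simp [h0]
  rw [p.as_sum_range_C_mul_X_pow, Finset.sum_mul, map_sum]
  refine Finset.sum_eq_zero fun k hk => ?_
  rw [mul_assoc, meixnerFunctional_C_mul, meixnerFunctional_X_pow_mul, mul_zero]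
  rw [degree_eq_natDegree h0, Nat.cast_lt] at hp
  have := Finset.mem_range.1 hk
  omega

lemma meixnerFunctional_meixnerPoly_mul_of_ne {m n : ℕ} (h : m ≠ n) :
    meixnerFunctional hγ hμ0 hμ1 (meixnerPoly γ μ m * meixnerPoly γ μ n) = 0 := by
  rcases h.lt_or_gt with h | h
  · exact meixnerFunctional_mul_eq_zero hγ hμ0 hμ1 (by rw [degree_meixnerPoly]; exact_mod_cast h)
  · rw [mul_comm]
    exact meixnerFunctional_mul_eq_zero hγ hμ0 hμ1 (by rw [degree_meixnerPoly]; exact_mod_cast h)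

lemma nrm2_eq (n : ℕ) :
    nrm2 γ μ n = meixnerFunctional hγ hμ0 hμ1 (meixnerPoly γ μ n * meixnerPoly γ μ n) := by
  rw [← mIP_eval]
  simp only [eval_meixnerPoly hγ hμ0 hμ1]
  rfl

end Functional

section Kernel

lemma nrm2_succ {γ μ : ℝ} (hγ : 0 < γ) (hμ0 : 0 < μ) (hμ1 : μ < 1) (n : ℕ) :
    nrm2 γ μ (n + 1) = betaR γ μ (n + 1) * nrm2 γ μ n := by
  rw [nrm2_eq hγ hμ0 hμ1, nrm2_eq hγ hμ0 hμ1]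
  have e : meixnerPoly γ μ (n + 1) * meixnerPoly γ μ (n + 1) =
      C (betaR γ μ (n + 1)) * (meixnerPoly γ μ n * meixnerPoly γ μ n) +
      meixnerPoly γ μ (n + 2) * meixnerPoly γ μ n +
      C (alphaR γ μ (n + 1) - alphaR γ μ n) * (meixnerPoly γ μ n * meixnerPoly γ μ (n + 1)) -
      C (betaR γ μ n) * (meixnerPoly γ μ (n - 1) * meixnerPoly γ μ (n + 1)) := by
    have h1 := meixnerPoly_succ γ μ n
    have h2 := meixnerPoly_succ γ μ (n + 1)
    rw [Nat.add_sub_cancel] at h2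
    rw [C_sub]
    linear_combination meixnerPoly γ μ n * h2 - meixnerPoly γ μ (n + 1) * h1
  rw [e, map_sub, map_add, map_add, meixnerFunctional_C_mul, meixnerFunctional_C_mul,
    meixnerFunctional_C_mul, meixnerFunctional_meixnerPoly_mul_of_ne hγ hμ0 hμ1 (show n + 2 ≠ n by omega),
    meixnerFunctional_meixnerPoly_mul_of_ne hγ hμ0 hμ1 (show n ≠ n + 1 by omega),
    meixnerFunctional_meixnerPoly_mul_of_ne hγ hμ0 hμ1 (show n - 1 ≠ n + 1 by omega)]
  ring

lemma betaR_succ_pos {γ μ : ℝ} (hγ : 0 < γ) (hμ0 : 0 < μ) (hμ1 : μ < 1) (n : ℕ) :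
    0 < betaR γ μ (n + 1) := by
  have h1 : 0 < 1 - μ := by linarith
  have h2 : 0 < ((n + 1 : ℕ) : ℝ) + γ - 1 := by push_cast; linarith [n.cast_nonneg (α := ℝ)]
  unfold betaR
  positivity

lemma nrm2_pos {γ μ : ℝ} (hγ : 0 < γ) (hμ0 : 0 < μ) (hμ1 : μ < 1) (n : ℕ) : 0 < nrm2 γ μ n := by
  induction n with
  | zero =>
    rw [nrm2_eq hγ hμ0 hμ1]
    simpa [meixnerPoly] using meixnerFunctional_one_pos hγ hμ0 hμ1
  | succ n ih =>
    rw [nrm2_succ hγ hμ0 hμ1]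
    exact mul_pos (betaR_succ_pos hγ hμ0 hμ1 n) ih

/-- The Christoffel–Darboux formula. -/
lemma sub_mul_sum_MeixnerM {γ μ : ℝ} (hγ : 0 < γ) (hμ0 : 0 < μ) (hμ1 : μ < 1) (n : ℕ)
    (x y : ℝ) :
    (x - y) * ∑ k ∈ Finset.range (n + 1), MeixnerM γ μ k x / nrm2 γ μ k * MeixnerM γ μ k y =
      MeixnerM γ μ (n + 1) x / nrm2 γ μ n * MeixnerM γ μ n y +
        -(MeixnerM γ μ n x / nrm2 γ μ n) * MeixnerM γ μ (n + 1) y := by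
  induction n with
  | zero =>
    simp only [← eval_meixnerPoly hγ hμ0 hμ1]
    simp [meixnerPoly]
    ring
  | succ n ih =>
    rw [Finset.sum_range_succ, mul_add, ih, nrm2_succ hγ hμ0 hμ1,
      MeixnerM_recurrence hγ hμ0 hμ1 n x, MeixnerM_recurrence hγ hμ0 hμ1 n y]
    have h1 := (nrm2_pos hγ hμ0 hμ1 n).ne'
    have h2 := (betaR_succ_pos hγ hμ0 hμ1 n).ne'
    field_simp
    ring

lemma one_add_Klm_pos {γ μ lam : ℝ} (hγ : 0 < γ) (hμ0 : 0 < μ) (hμ1 : μ < 1) (hlam : 0 < lam)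
    (α : ℝ) (i j n : ℕ) : 0 < 1 + lam * Klm γ μ i j j n α α := by
  have : 0 ≤ Klm γ μ i j j n α α := Finset.sum_nonneg fun k _ =>
    div_nonneg (mul_self_nonneg _) (nrm2_pos hγ hμ0 hμ1 k).le
  positivity

/-- The Sobolev polynomial in terms of the kernel. -/
lemma IsSobolevOP.eval_eq {γ μ lam α : ℝ} (hγ : 0 < γ) (hμ0 : 0 < μ) (hμ1 : μ < 1)
    (hlam : 0 < lam) {i j n : ℕ} {Q : ℝ[X]} (hQ : IsSobolevOP γ μ lam α i j (n + 1) Q) (x : ℝ) :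
    Q.eval x = MeixnerM γ μ (n + 1) x -
      lam * Dk i j (MeixnerM γ μ (n + 1)) α / (1 + lam * Klm γ μ i j j n α α) *
        Klm γ μ i 0 j n x α := by
  obtain ⟨hmonic, hdeg, horth⟩ := hQ
  have hM := meixnerPoly_monic_natDegree γ μ (n + 1)
  have hev (m : ℕ) : (fun y => (meixnerPoly γ μ m).eval y) = MeixnerM γ μ m :=
    funext fun y => eval_meixnerPoly hγ hμ0 hμ1 m y
  have hlt : (Q - meixnerPoly γ μ (n + 1)).degree < ((n + 1 : ℕ) : WithBot ℕ) := by
    have hQd : Q.degree = ((n + 1 : ℕ) : WithBot ℕ) := by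
      rw [degree_eq_natDegree hmonic.ne_zero, hdeg]
    rw [← hQd]
    exact degree_sub_lt_left (hQd.trans (degree_meixnerPoly γ μ _).symm) hmonic.ne_zero
      (hmonic.leadingCoeff.trans hM.1.leadingCoeff.symm)
  obtain ⟨d, hd⟩ := exists_eq_sum_meixnerPoly γ μ (n + 1) _ hlt
  set t := Dk i j (fun y => Q.eval y) α with ht
  have hQsum : Q = meixnerPoly γ μ (n + 1) +
      ∑ k ∈ Finset.range (n + 1), C (d k) * meixnerPoly γ μ k := by
    rw [← hd]; ring
  have hdk : ∀ k ∈ Finset.range (n + 1),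
      d k = -(lam * t) * (Dk i j (MeixnerM γ μ k) α / nrm2 γ μ k) := by
    intro k hk
    have hk' := Finset.mem_range.1 hk
    have h := horth (meixnerPoly γ μ k) (by rw [degree_meixnerPoly]; exact_mod_cast hk')
    rw [sIP, mIP_eval hγ hμ0 hμ1, ← ht, hev, hQsum, add_mul, map_add,
      meixnerFunctional_meixnerPoly_mul_of_ne hγ hμ0 hμ1 (by omega), Finset.sum_mul, map_sum,
      Finset.sum_eq_single k, mul_assoc, meixnerFunctional_C_mul, ← nrm2_eq hγ hμ0 hμ1] at h
    · have := (nrm2_pos hγ hμ0 hμ1 k).ne'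
      field_simp
      linear_combination h
    · intro m _ hm
      rw [mul_assoc, meixnerFunctional_C_mul,
        meixnerFunctional_meixnerPoly_mul_of_ne hγ hμ0 hμ1 hm, mul_zero]
    · exact fun h => absurd hk h
  have heval (y : ℝ) : Q.eval y = 1 * MeixnerM γ μ (n + 1) y + -(lam * t) *
      ∑ k ∈ Finset.range (n + 1), Dk i j (MeixnerM γ μ k) α / nrm2 γ μ k * MeixnerM γ μ k y := by
    rw [hQsum, eval_add, eval_finsetSum, eval_meixnerPoly hγ hμ0 hμ1, Finset.mul_sum, one_mul]
    congr 1
    refine Finset.sum_congr rfl fun k hk => ?_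
    rw [eval_mul, eval_C, eval_meixnerPoly hγ hμ0 hμ1, hdk k hk]
    ring
  have hK : ∑ k ∈ Finset.range (n + 1), Dk i j (MeixnerM γ μ k) α / nrm2 γ μ k *
      Dk i j (MeixnerM γ μ k) α = Klm γ μ i j j n α α :=
    Finset.sum_congr rfl fun k _ => by ring
  have hK0 : ∑ k ∈ Finset.range (n + 1), Dk i j (MeixnerM γ μ k) α / nrm2 γ μ k *
      MeixnerM γ μ k x = Klm γ μ i 0 j n x α :=
    Finset.sum_congr rfl fun k _ => by
      rw [Dk_zero]; ring
  have hpos := (one_add_Klm_pos hγ hμ0 hμ1 hlam α i j n).ne'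
  have htval : t = Dk i j (MeixnerM γ μ (n + 1)) α / (1 + lam * Klm γ μ i j j n α α) := by
    have h : t = 1 * Dk i j (MeixnerM γ μ (n + 1)) α + -(lam * t) * Klm γ μ i j j n α α := by
      rw [← hK, ← Dk_sum_mul, ← Dk_add_mul, ← funext heval]
    rw [eq_div_iff hpos]
    linear_combination h
  rw [heval, hK0, htval]
  ring

/-- The connection formula `Q_n = A_{1,n} M_n + B_{1,n} M_{n-1}`. -/
lemma IsSobolevOP.eval_eq_A1_B1 {γ μ lam α : ℝ} (hγ : 0 < γ) (hμ0 : 0 < μ) (hμ1 : μ < 1)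
    (hlam : 0 < lam) {i j n : ℕ} {Q : ℝ[X]} (hQ : IsSobolevOP γ μ lam α i j (n + 1) Q) {x : ℝ}
    (hbr : br i (x - α) (j + 1) ≠ 0) :
    Q.eval x = A1 γ μ lam α i j (n + 1) x * MeixnerM γ μ (n + 1) x +
      B1 γ μ lam α i j (n + 1) x * MeixnerM γ μ n x := by
  have hK : br i (x - α) (j + 1) * Klm γ μ i 0 j n x α =
      ∑ k ∈ Finset.range (j + 1), (j.factorial : ℝ) / k.factorial * br i (x - α) k *
        (MeixnerM γ μ (n + 1) x / nrm2 γ μ n * Dk i k (MeixnerM γ μ n) α +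
          -(MeixnerM γ μ n x / nrm2 γ μ n) * Dk i k (MeixnerM γ μ (n + 1)) α) := by
    have h := br_mul_Dk i j x α fun y =>
      ∑ k ∈ Finset.range (n + 1), MeixnerM γ μ k x / nrm2 γ μ k * MeixnerM γ μ k y
    simp only [sub_mul_sum_MeixnerM hγ hμ0 hμ1, Dk_add_mul, Dk_sum_mul] at h
    rw [← h]
    congr 1
    refine Finset.sum_congr rfl fun k _ => ?_
    rw [Dk_zero]
    ring
  have hcoeff : (∑ k ∈ Finset.range (j + 1), acoef γ μ lam α i j (n + 1) k * br i (x - α) k) *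
        MeixnerM γ μ (n + 1) x +
      (∑ k ∈ Finset.range (j + 1), bcoef γ μ lam α i j (n + 1) k * br i (x - α) k) *
        MeixnerM γ μ n x =
      -(lam * Dk i j (MeixnerM γ μ (n + 1)) α / (1 + lam * Klm γ μ i j j n α α)) *
        (br i (x - α) (j + 1) * Klm γ μ i 0 j n x α) := by
    rw [hK, Finset.sum_mul, Finset.sum_mul, ← Finset.sum_add_distrib, Finset.mul_sum]
    refine Finset.sum_congr rfl fun k _ => ?_
    simp only [acoef, bcoef, Nat.add_sub_cancel, div_eq_mul_inv, mul_inv]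
    ring
  rw [hQ.eval_eq hγ hμ0 hμ1 hlam, A1, B1]
  linear_combination (-1 / br i (x - α) (j + 1)) * hcoeff +
    lam * Dk i j (MeixnerM γ μ (n + 1)) α / (1 + lam * Klm γ μ i j j n α α) *
      Klm γ μ i 0 j n x α * mul_inv_cancel₀ hbr

end Kernel

/-- `Q_{n−1}^{(i)}(x) = A_{2,n}(x) M_n(x) + B_{2,n}(x) M_{n−1}(x)`. -/
theorem sobolev_shifted_connection_formula (γ μ lam α : ℝ) (hγ : 0 < γ) (hμ0 : 0 < μ)
    (hμ1 : μ < 1) (hlam : 0 < lam) (hα : α ≤ 0) (j i n : ℕ) (hi : i = 1 ∨ i = 2)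
    (hn : 2 ≤ n) (Q : Polynomial ℝ) (hQ : IsSobolevOP γ μ lam α i j (n - 1) Q) (x : ℝ)
    (hbr : br i (x - α) (j + 1) ≠ 0) :
    Q.eval x =
      A2 γ μ lam α i j n x * MeixnerM γ μ n x +
        B2 γ μ lam α i j n x * MeixnerM γ μ (n - 1) x := by
  obtain ⟨m, rfl⟩ : ∃ m, n = m + 2 := ⟨n - 2, by omega⟩
  rw [show m + 2 - 1 = m + 1 by omega] at hQ ⊢
  have hβ := (betaR_succ_pos hγ hμ0 hμ1 m).ne'
  rw [hQ.eval_eq_A1_B1 hγ hμ0 hμ1 hlam hbr, B2, A2, show m + 2 - 1 = m + 1 by omega,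
    MeixnerM_recurrence hγ hμ0 hμ1]
  field_simp
  ring
end
end
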